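/- arXiv:1011.5200 — 8 statements merged into one kernel-verified Lean document; each statement's English description precedes it below -/
import Mathlib

section
/- For every number of characters c ≥ 1 there exists a constant C > 0 (depending only on c) such that the following holds. Let Σ be a finite alphabet, let S ⊆ Σ^c be a set of n ≥ 2 keys, let q ∈ Σ^c \ S, and let w be any integer with w ≥ (1 + 1/c)·log₂ n. Let h be a random simple tabulation hash function into (ZMod 2)^w, with hash values interpreted as integers in {0, …, 2^w − 1} via binary representation and compared as integers. Then | Pr[h(q) < min_{x ∈ S} h(x)] − 1/n | ≤ C·(log₂ n)² / n^{1 + 1/c}. -/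
open Finset

/-- Simple tabulation hashing. -/
def tabHash {c b : ℕ} {A : Type} (T : Fin c → A → (Fin b → ZMod 2)) (x : Fin c → A) :
    Fin b → ZMod 2 :=
  ∑ i, T i (x i)

/-- Probability over a uniformly random choice of all tables. -/
noncomputable def tabPr (c b : ℕ) (A : Type)
    (P : (Fin c → A → (Fin b → ZMod 2)) → Prop) : ℝ :=
  (Nat.card {T : Fin c → A → (Fin b → ZMod 2) // P T} : ℝ) /
    (Nat.card (Fin c → A → (Fin b → ZMod 2)) : ℝ)

/-- The integer in `{0, …, 2^b − 1}` whose binary digits are the coordinates of a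
`b`-bit string. -/
def binVal {b : ℕ} (v : Fin b → ZMod 2) : ℕ :=
  ∑ i, (v i).val * 2 ^ (i : ℕ)


set_option linter.unusedSectionVars false

namespace TabAux

noncomputable def ind (P : Prop) : ℝ := by
  classical exact if P then 1 else 0

lemma ind_true {P : Prop} (h : P) : ind P = 1 := by simp [ind, h]
lemma ind_false {P : Prop} (h : ¬ P) : ind P = 0 := by simp [ind, h]
lemma ind_nonneg (P : Prop) : 0 ≤ ind P := by unfold ind; split_ifs <;> norm_num
lemma ind_le_one (P : Prop) : ind P ≤ 1 := by unfold ind; split_ifs <;> norm_num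
lemma ind_mono {P Q : Prop} (h : P → Q) : ind P ≤ ind Q := by
  by_cases hp : P
  · rw [ind_true hp, ind_true (h hp)]
  · rw [ind_false hp]; exact ind_nonneg _
lemma ind_and (P Q : Prop) : ind (P ∧ Q) = ind P * ind Q := by
  by_cases hp : P <;> by_cases hq : Q <;> simp [ind, hp, hq]
lemma ind_not (P : Prop) : ind (¬ P) = 1 - ind P := by
  by_cases hp : P <;> simp [ind, hp]
lemma ind_congr {P Q : Prop} (h : P ↔ Q) : ind P = ind Q := by rw [propext h]

lemma ind_exists_le {ι : Type*} (s : Finset ι) (P : Prop) (Q : ι → Prop)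
    (h : P → ∃ i ∈ s, Q i) : ind P ≤ ∑ i ∈ s, ind (Q i) := by
  by_cases hp : P
  · obtain ⟨i, hi, hq⟩ := h hp
    rw [ind_true hp, ← ind_true hq]
    exact Finset.single_le_sum (f := fun i => ind (Q i)) (fun i _ => ind_nonneg _) hi
  · rw [ind_false hp]; exact Finset.sum_nonneg (fun i _ => ind_nonneg _)

lemma sum_ind_eq_card {ι : Type*} (s : Finset ι) (Q : ι → Prop) [DecidablePred Q] :
    ∑ i ∈ s, ind (Q i) = ((s.filter Q).card : ℝ) := by
  rw [Finset.card_filter]; push_cast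
  apply Finset.sum_congr rfl; intro i _
  by_cases h : Q i <;> simp [ind, h]

/-! Binary values -/

def toFin (b : ℕ) : (Fin b → ZMod 2) ≃ Fin (2 ^ b) :=
  (finFunctionFinEquiv (m := 2) (n := b) : (Fin b → Fin 2) ≃ Fin (2 ^ b))

lemma binVal_eq {b : ℕ} (v : Fin b → ZMod 2) : binVal v = (toFin b v : ℕ) :=
  (finFunctionFinEquiv_apply (m := 2) (n := b) v).symm

lemma binVal_lt {b : ℕ} (v : Fin b → ZMod 2) : binVal v < 2 ^ b := by
  rw [binVal_eq]; exact Fin.isLt _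

lemma binVal_inj {b : ℕ} : Function.Injective (binVal (b := b)) := by
  intro u v h
  rw [binVal_eq, binVal_eq] at h
  exact (toFin b).injective (Fin.ext h)

lemma sum_binVal {b : ℕ} (g : ℕ → ℝ) :
    ∑ u : Fin b → ZMod 2, g (binVal u) = ∑ v ∈ range (2 ^ b), g v := by
  rw [Finset.sum_range (n := 2 ^ b) g]
  exact Fintype.sum_equiv (toFin b) _ _ (fun u => by rw [binVal_eq])

lemma sum_low {b : ℕ} (t : ℕ) (ht : t ≤ 2 ^ b) :
    ∑ u : Fin b → ZMod 2, ind (binVal u < t) = t := by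
  rw [sum_binVal (fun v => ind (v < t)), sum_ind_eq_card]
  congr 1
  have : (range (2 ^ b)).filter (fun v => v < t) = range t := by
    ext v; simp; omega
  rw [this, card_range]

lemma sum_low_shift {b : ℕ} (t : ℕ) (ht : t ≤ 2 ^ b) (z : Fin b → ZMod 2) :
    ∑ u : Fin b → ZMod 2, ind (binVal (z + u) < t) = t := by
  rw [← sum_low (b := b) t ht]
  exact Fintype.sum_equiv (Equiv.addLeft z) _ _ (fun u => rfl)

lemma sum_eq_shift {b : ℕ} (t : ℕ) (ht : t < 2 ^ b) (z : Fin b → ZMod 2) :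
    ∑ u : Fin b → ZMod 2, ind (binVal (z + u) = t) = 1 := by
  have : ∑ u : Fin b → ZMod 2, ind (binVal (z + u) = t) =
      ∑ u : Fin b → ZMod 2, ind (binVal u = t) :=
    Fintype.sum_equiv (Equiv.addLeft z) _ _ (fun u => rfl)
  rw [this, sum_binVal (fun v => ind (v = t)), sum_ind_eq_card]
  have : (range (2 ^ b)).filter (fun v => v = t) = {t} := by
    ext v; simp only [mem_filter, mem_range, mem_singleton]
    constructor
    · exact fun h => h.2
    · rintro rfl; exact ⟨ht, rfl⟩
  rw [this]; simp

lemma card_V (b : ℕ) : (Fintype.card (Fin b → ZMod 2) : ℝ) = 2 ^ b := by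
  simp [ZMod.card]

lemma binVal_lt_pow_iff {b : ℕ} (k : ℕ) (v : Fin b → ZMod 2) :
    binVal v < 2 ^ k ↔ ∀ i : Fin b, k ≤ (i : ℕ) → v i = 0 := by
  constructor
  · intro h i hi
    by_contra hne
    have h1 : 1 ≤ (v i).val := Nat.one_le_iff_ne_zero.mpr (by rwa [Ne, ZMod.val_eq_zero])
    have h2 : (v i).val * 2 ^ (i : ℕ) ≤ binVal v :=
      Finset.single_le_sum (f := fun i : Fin b => (v i).val * 2 ^ (i : ℕ))
        (fun _ _ => Nat.zero_le _) (Finset.mem_univ i)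
    have h3 : 2 ^ k ≤ 2 ^ (i : ℕ) := Nat.pow_le_pow_right (by norm_num) hi
    nlinarith
  · intro h
    by_cases hk : b ≤ k
    · exact lt_of_lt_of_le (binVal_lt v) (Nat.pow_le_pow_right (by norm_num) hk)
    · push Not at hk
      -- compare with a k-bit string
      have h1 : binVal v = binVal (fun i : Fin k => v ⟨i, by omega⟩) := by
        unfold binVal
        symm
        apply Finset.sum_of_injOn (fun i : Fin k => (⟨i, by omega⟩ : Fin b))
        · intro i _ j _ hij; simpa [Fin.ext_iff] using hij
        · intro i _; simp
        · intro i _ hi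
          rw [h i]
          · simp
          · by_contra hlt
            push Not at hlt
            exact hi ⟨⟨i, hlt⟩, by simp⟩
        · intro i _; rfl
      rw [h1]; exact binVal_lt _

lemma low_add {b k : ℕ} {u v : Fin b → ZMod 2} (hu : binVal u < 2 ^ k) (hv : binVal v < 2 ^ k) :
    binVal (u + v) < 2 ^ k := by
  rw [binVal_lt_pow_iff] at *
  intro i hi
  simp [hu i hi, hv i hi]

lemma V_add_self {b : ℕ} (u : Fin b → ZMod 2) : u + u = 0 := by
  funext i; exact CharTwo.add_self_eq_zero _

/-! Expectation -/

abbrev Tab (c b : ℕ) (A : Type) := Fin c → A → (Fin b → ZMod 2)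

section
variable {c b : ℕ} {A : Type} [Fintype A] [DecidableEq A]

noncomputable def E (f : Tab c b A → ℝ) : ℝ := (∑ T, f T) / (Fintype.card (Tab c b A) : ℝ)

lemma cardTab_pos : (0 : ℝ) < (Fintype.card (Tab c b A) : ℝ) := by
  exact_mod_cast Fintype.card_pos

lemma tabPr_eq (P : Tab c b A → Prop) : tabPr c b A P = E (fun T => ind (P T)) := by
  classical
  unfold tabPr E
  rw [sum_ind_eq_card, Nat.card_eq_fintype_card, Nat.card_eq_fintype_card, Fintype.card_subtype]

lemma E_mono {f g : Tab c b A → ℝ} (h : ∀ T, f T ≤ g T) : E f ≤ E g := by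
  unfold E
  exact div_le_div_of_nonneg_right (Finset.sum_le_sum (fun T _ => h T)) cardTab_pos.le

lemma E_const (r : ℝ) : E (fun _ : Tab c b A => r) = r := by
  unfold E
  have := cardTab_pos (c := c) (b := b) (A := A)
  rw [Finset.sum_const, Finset.card_univ, nsmul_eq_mul]
  field_simp

lemma E_add (f g : Tab c b A → ℝ) : E (fun T => f T + g T) = E f + E g := by
  unfold E; rw [Finset.sum_add_distrib, add_div]

lemma E_mul (r : ℝ) (f : Tab c b A → ℝ) : E (fun T => r * f T) = r * E f := by
  unfold E; rw [← Finset.mul_sum, mul_div_assoc]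

lemma E_sum {ι : Type*} (s : Finset ι) (f : ι → Tab c b A → ℝ) :
    E (fun T => ∑ i ∈ s, f i T) = ∑ i ∈ s, E (f i) := by
  unfold E; rw [Finset.sum_comm, Finset.sum_div]

lemma E_nonneg {f : Tab c b A → ℝ} (h : ∀ T, 0 ≤ f T) : 0 ≤ E f := by
  rw [← E_const (c := c) (b := b) (A := A) 0]; exact E_mono h

def sh (j : Fin c) (a : A) (u : Fin b → ZMod 2) (T : Tab c b A) : Tab c b A :=
  fun i x => T i x + if i = j ∧ x = a then u else 0

lemma hash_sh (j : Fin c) (a : A) (u : Fin b → ZMod 2) (T : Tab c b A) (x : Fin c → A) :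
    tabHash (sh j a u T) x = tabHash T x + if x j = a then u else 0 := by
  unfold tabHash sh
  rw [Finset.sum_add_distrib]
  congr 1
  rw [Finset.sum_eq_single j]
  · simp
  · intro i _ hi; simp [hi]
  · simp

lemma hash_sh_of_ne {j : Fin c} {a : A} (u : Fin b → ZMod 2) (T : Tab c b A) {x : Fin c → A}
    (h : x j ≠ a) : tabHash (sh j a u T) x = tabHash T x := by
  rw [hash_sh]; simp [h]

lemma hash_sh_of_eq {j : Fin c} {a : A} (u : Fin b → ZMod 2) (T : Tab c b A) {x : Fin c → A}
    (h : x j = a) : tabHash (sh j a u T) x = tabHash T x + u := by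
  rw [hash_sh]; simp [h]

lemma E_sh (j : Fin c) (a : A) (u : Fin b → ZMod 2) (f : Tab c b A → ℝ) :
    E (fun T => f (sh j a u T)) = E f := by
  unfold E
  congr 1
  exact Fintype.sum_equiv
    (Equiv.addRight (fun i x => if i = j ∧ x = a then u else 0 : Tab c b A)) _ _ (fun T => rfl)

lemma E_avg (j : Fin c) (a : A) (f : Tab c b A → ℝ) :
    E f = E (fun T => (∑ u, f (sh j a u T)) / 2 ^ b) := by
  have h : E (fun T => (∑ u, f (sh j a u T)) / 2 ^ b) =
      (1 / 2 ^ b) * E (fun T => ∑ u, f (sh j a u T)) := by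
    rw [← E_mul]; congr 1; funext T; ring
  rw [h, E_sum]
  simp only [E_sh]
  rw [Finset.sum_const, Finset.card_univ, nsmul_eq_mul, card_V]
  field_simp

/-- A quantity with a factor invariant under the shift. -/
lemma E_avg_mul (j : Fin c) (a : A) (F g : Tab c b A → ℝ)
    (hF : ∀ u T, F (sh j a u T) = F T) :
    E (fun T => F T * g T) = E (fun T => F T * ((∑ u, g (sh j a u T)) / 2 ^ b)) := by
  rw [E_avg j a]
  congr 1; funext T
  simp only [hF]
  rw [← Finset.mul_sum, mul_div_assoc]

def Miss (T : Tab c b A) (B : Finset (Fin c → A)) (t : ℕ) : Prop :=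
  ∀ x ∈ B, ¬ binVal (tabHash T x) < t

lemma step_eq (j : Fin c) (a : A) (F : Tab c b A → ℝ) (hF : ∀ u T, F (sh j a u T) = F T)
    (B : Finset (Fin c → A)) (t : ℕ) :
    E (fun T => F T * ind (Miss T B t)) =
    E (fun T => F T * ind (Miss T (B.filter (fun x => x j ≠ a)) t) *
      ((∑ u, ind (Miss (sh j a u T) (B.filter (fun x => x j = a)) t)) / 2 ^ b)) := by
  rw [← E_avg_mul j a (fun T => F T * ind (Miss T (B.filter (fun x => x j ≠ a)) t))
    (fun T => ind (Miss T (B.filter (fun x => x j = a)) t))]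
  · congr 1; funext T
    rw [mul_assoc, ← ind_and]
    congr 1
    apply ind_congr
    simp only [Miss, Finset.mem_filter]
    constructor
    · intro h; exact ⟨fun x hx => h x hx.1, fun x hx => h x hx.1⟩
    · rintro ⟨h1, h2⟩ x hx
      by_cases hxa : x j = a
      · exact h2 x ⟨hx, hxa⟩
      · exact h1 x ⟨hx, hxa⟩
  · intro u T
    simp only [hF]
    congr 1
    apply ind_congr
    simp only [Miss, Finset.mem_filter]
    constructor
    · intro h x hx; rw [← hash_sh_of_ne u T hx.2]; exact h x hx
    · intro h x hx; rw [hash_sh_of_ne u T hx.2]; exact h x hx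

end


section
variable {c b : ℕ} {A : Type} [Fintype A] [DecidableEq A]

lemma exists_light (hc : 1 ≤ c) (q : Fin c → A) (B : Finset (Fin c → A)) (hq : q ∉ B)
    (hB : B.Nonempty) :
    ∃ (j : Fin c) (a : A), a ≠ q j ∧ (B.filter (fun x => x j = a)).Nonempty ∧
      ((B.filter (fun x => x j = a)).card : ℝ) ≤ 2 * (B.card : ℝ) ^ (1 - 1 / (c : ℝ)) := by
  by_contra hcon
  push Not at hcon
  have hb1 : (1 : ℝ) ≤ (B.card : ℝ) := by exact_mod_cast hB.card_pos
  have hb0 : (0 : ℝ) < (B.card : ℝ) := by linarith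
  set r : ℝ := (B.card : ℝ) ^ (1 / (c : ℝ)) with hr
  have hc0 : (c : ℝ) ≠ 0 := by positivity
  have hr1 : 1 ≤ r := Real.one_le_rpow hb1 (by positivity)
  have hrc : r ^ c = B.card := by
    rw [hr, ← Real.rpow_natCast, ← Real.rpow_mul hb0.le]
    field_simp; simp
  have hrs : (B.card : ℝ) ^ (1 - 1 / (c : ℝ)) * r = B.card := by
    rw [hr, ← Real.rpow_add hb0]; simp
  set s : ℝ := (B.card : ℝ) ^ (1 - 1 / (c : ℝ)) with hs
  have hs0 : 0 < s := Real.rpow_pos_of_pos hb0 _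
  let K : Fin c → Finset A := fun j => (B.image (fun x => x j)).erase (q j)
  have hK : ∀ j, (((insert (q j) (K j)).card : ℕ) : ℝ) ≤ r := by
    intro j
    have h1 : ((K j).card : ℝ) * (2 * s) ≤ B.card := by
      have h2 : ∑ a ∈ K j, (2 * s) ≤ ∑ a ∈ K j, ((B.filter (fun x => x j = a)).card : ℝ) := by
        apply Finset.sum_le_sum
        intro a ha
        rw [Finset.mem_erase, Finset.mem_image] at ha
        obtain ⟨hne, x, hx, hxa⟩ := ha
        exact (hcon j a hne ⟨x, by simp [hx, hxa]⟩).le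
      rw [Finset.sum_const, nsmul_eq_mul] at h2
      refine h2.trans ?_
      have h3 : ∑ a ∈ K j, (B.filter (fun x => x j = a)).card ≤ B.card := by
        rw [← Finset.card_biUnion]
        · apply Finset.card_le_card
          intro x hx
          simp only [Finset.mem_biUnion, Finset.mem_filter] at hx
          obtain ⟨_, _, h, _⟩ := hx
          exact h
        · intro a _ a' _ haa
          simp only [Function.onFun]
          rw [Finset.disjoint_left]
          intro x hx hx'
          simp only [Finset.mem_filter] at hx hx'
          exact haa (hx.2.symm.trans hx'.2)
      exact_mod_cast h3
    have h4 : 2 * ((K j).card : ℝ) ≤ r := by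
      rw [← hrs] at h1
      have : s * (2 * ((K j).card : ℝ)) ≤ s * r := by linarith
      exact le_of_mul_le_mul_left this hs0
    have h5 : (insert (q j) (K j)).card = (K j).card + 1 :=
      Finset.card_insert_of_notMem (by simp [K])
    rw [h5]; push_cast
    rcases Nat.eq_zero_or_pos (K j).card with h | h
    · rw [h]; simpa using hr1
    · have : (1 : ℝ) ≤ (K j).card := by exact_mod_cast h
      linarith
  have hsub : insert q B ⊆ Fintype.piFinset (fun j => insert (q j) (K j)) := by
    intro x hx
    rw [Fintype.mem_piFinset]
    intro j
    rw [Finset.mem_insert] at hx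
    rcases hx with rfl | hx
    · simp
    · by_cases h : x j = q j
      · simp [h]
      · apply Finset.mem_insert_of_mem
        simp only [K, Finset.mem_erase, Finset.mem_image]
        exact ⟨h, x, hx, rfl⟩
  have h1 := Finset.card_le_card hsub
  rw [Finset.card_insert_of_notMem hq, Fintype.card_piFinset] at h1
  have h2 : ((B.card + 1 : ℕ) : ℝ) ≤ ∏ j, (((insert (q j) (K j)).card : ℕ) : ℝ) := by
    exact_mod_cast h1
  have h3 : ∏ j, (((insert (q j) (K j)).card : ℕ) : ℝ) ≤ ∏ j : Fin c, r :=
    Finset.prod_le_prod (fun _ _ => by positivity) (fun j _ => hK j)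
  rw [Finset.prod_const, Finset.card_univ, Fintype.card_fin, hrc] at h3
  push_cast at h2
  linarith

lemma peel_induct (hc : 1 ≤ c) (q : Fin c → A) (n : ℕ) {P : Finset (Fin c → A) → Prop}
    (h0 : P ∅)
    (hstep : ∀ (B : Finset (Fin c → A)) (j : Fin c) (a : A), a ≠ q j →
      ((B.filter (fun x => x j = a)).card : ℝ) ≤ 2 * (n : ℝ) ^ (1 - 1 / (c : ℝ)) →
      P (B.filter (fun x => x j ≠ a)) → P B) :
    ∀ B : Finset (Fin c → A), q ∉ B → B.card ≤ n → P B := by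
  intro B
  induction B using Finset.strongInduction with
  | H B ih =>
    intro hq hn
    rcases B.eq_empty_or_nonempty with rfl | hB
    · exact h0
    · obtain ⟨j, a, hne, hG, hcard⟩ := exists_light hc q B hq hB
      refine hstep B j a hne (hcard.trans ?_) (ih _ ?_ ?_ ?_)
      · have : (B.card : ℝ) ≤ n := by exact_mod_cast hn
        have hc1 : 0 ≤ 1 - 1 / (c : ℝ) := by
          have : (1 : ℝ) ≤ c := by exact_mod_cast hc
          rw [sub_nonneg, div_le_one (by linarith)]; exact this
        gcongr
      · obtain ⟨x, hx⟩ := hG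
        rw [Finset.mem_filter] at hx
        rw [Finset.filter_ssubset]
        exact ⟨x, hx.1, by simp [hx.2]⟩
      · simp [hq]
      · exact (Finset.card_filter_le _ _).trans hn

lemma card_split (B : Finset (Fin c → A)) (j : Fin c) (a : A) :
    (B.card : ℝ) = (B.filter (fun x => x j = a)).card + (B.filter (fun x => x j ≠ a)).card := by
  have := Finset.card_filter_add_card_filter_not (s := B) (fun x => x j = a)
  exact_mod_cast this.symm

lemma sum_hits (G : Finset (Fin c → A)) (T : Tab c b A) (t : ℕ) (ht : t ≤ 2 ^ b) :
    ∑ u, ∑ x ∈ G, ind (binVal (tabHash T x + u) < t) = (G.card : ℝ) * t := by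
  rw [Finset.sum_comm]
  simp only [sum_low_shift t ht]
  simp

lemma miss_sh_iff (B : Finset (Fin c → A)) (j : Fin c) (a : A) (T : Tab c b A) (t : ℕ)
    (u : Fin b → ZMod 2) :
    Miss (sh j a u T) (B.filter (fun x => x j = a)) t ↔
      ∀ x ∈ B.filter (fun x => x j = a), ¬ binVal (tabHash T x + u) < t := by
  constructor
  · intro h x hx
    rw [← hash_sh_of_eq u T (Finset.mem_filter.mp hx).2]; exact h x hx
  · intro h x hx
    rw [hash_sh_of_eq u T (Finset.mem_filter.mp hx).2]; exact h x hx

lemma avg_lower (G : Finset (Fin c → A)) (T : Tab c b A) (t : ℕ) (ht : t ≤ 2 ^ b) :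
    1 - (G.card : ℝ) * (t / 2 ^ b) ≤
    (∑ u, ind (∀ x ∈ G, ¬ binVal (tabHash T x + u) < t)) / 2 ^ b := by
  have h1 : ∀ u : Fin b → ZMod 2, 1 - ∑ x ∈ G, ind (binVal (tabHash T x + u) < t) ≤
      ind (∀ x ∈ G, ¬ binVal (tabHash T x + u) < t) := by
    intro u
    have := ind_exists_le G (¬ ∀ x ∈ G, ¬ binVal (tabHash T x + u) < t)
      (fun x => binVal (tabHash T x + u) < t) (by intro h; push Not at h; simpa using h)
    rw [ind_not] at this
    linarith
  have h2 := Finset.sum_le_sum (fun u (_ : u ∈ Finset.univ) => h1 u)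
  rw [Finset.sum_sub_distrib, sum_hits G T t ht, Finset.sum_const, Finset.card_univ,
    nsmul_eq_mul, card_V] at h2
  rw [le_div_iff₀ (by positivity)]
  refine le_trans (le_of_eq ?_) h2
  field_simp

lemma avg_upper (G : Finset (Fin c → A)) (T : Tab c b A) (t k : ℕ) (ht : t ≤ 2 ^ b)
    (htk : t ≤ 2 ^ k) :
    (∑ u, ind (∀ x ∈ G, ¬ binVal (tabHash T x + u) < t)) / 2 ^ b ≤
    1 - (G.card : ℝ) * (t / 2 ^ b) +
    (t / 2 ^ b) * ∑ x ∈ G, ∑ y ∈ G.erase x, ind (binVal (tabHash T x + tabHash T y) < 2 ^ k) := by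
  have h1 : ∀ u : Fin b → ZMod 2, ind (∀ x ∈ G, ¬ binVal (tabHash T x + u) < t) ≤
      1 - ∑ x ∈ G, ind (binVal (tabHash T x + u) < t) +
      ∑ x ∈ G, ∑ y ∈ G.erase x, ind (binVal (tabHash T x + u) < t) *
        ind (binVal (tabHash T x + tabHash T y) < 2 ^ k) := by
    intro u
    set N := ∑ x ∈ G, ind (binVal (tabHash T x + u) < t) with hN
    have h2 : N * N - N ≤ ∑ x ∈ G, ∑ y ∈ G.erase x, ind (binVal (tabHash T x + u) < t) *
        ind (binVal (tabHash T x + tabHash T y) < 2 ^ k) := by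
      have h3 : N * N - N = ∑ x ∈ G, ∑ y ∈ G.erase x, ind (binVal (tabHash T x + u) < t) *
        ind (binVal (tabHash T y + u) < t) := by
        nth_rewrite 1 [hN]
        nth_rewrite 2 [hN]
        rw [Finset.sum_mul, ← Finset.sum_sub_distrib]
        apply Finset.sum_congr rfl
        intro x hx
        rw [← Finset.mul_sum, hN, ← Finset.add_sum_erase G _ hx, mul_add, ← ind_and, and_self]
        ring
      rw [h3]
      apply Finset.sum_le_sum; intro x _
      apply Finset.sum_le_sum; intro y _
      rw [← ind_and, ← ind_and]
      apply ind_mono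
      rintro ⟨hx, hy⟩
      refine ⟨hx, ?_⟩
      have := low_add (lt_of_lt_of_le hx htk) (lt_of_lt_of_le hy htk)
      have he : tabHash T x + u + (tabHash T y + u) = tabHash T x + tabHash T y := by
        rw [add_add_add_comm, V_add_self, add_zero]
      rwa [he] at this
    by_cases hm : ∀ x ∈ G, ¬ binVal (tabHash T x + u) < t
    · have hN0 : N = 0 := Finset.sum_eq_zero (fun x hx => ind_false (hm x hx))
      rw [ind_true hm]
      rw [hN0] at h2 ⊢
      linarith
    · rw [ind_false hm]
      nlinarith [sq_nonneg (N - 1)]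
  have h2 := Finset.sum_le_sum (fun u (_ : u ∈ Finset.univ) => h1 u)
  rw [Finset.sum_add_distrib, Finset.sum_sub_distrib, sum_hits G T t ht, Finset.sum_const,
    Finset.card_univ, nsmul_eq_mul, card_V] at h2
  have h3 : ∑ u, ∑ x ∈ G, ∑ y ∈ G.erase x, ind (binVal (tabHash T x + u) < t) *
        ind (binVal (tabHash T x + tabHash T y) < 2 ^ k) =
      t * ∑ x ∈ G, ∑ y ∈ G.erase x, ind (binVal (tabHash T x + tabHash T y) < 2 ^ k) := by
    rw [Finset.sum_comm, Finset.mul_sum]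
    apply Finset.sum_congr rfl; intro x _
    rw [Finset.sum_comm, Finset.mul_sum]
    apply Finset.sum_congr rfl; intro y _
    rw [← Finset.sum_mul, sum_low_shift t ht]
  rw [h3] at h2
  rw [div_le_iff₀ (by positivity)]
  refine le_trans h2 (le_of_eq ?_)
  field_simp

lemma E_q (hc : 1 ≤ c) (q : Fin c → A) (v : ℕ) (hv : v < 2 ^ b) :
    E (fun T : Tab c b A => ind (binVal (tabHash T q) = v)) = 1 / 2 ^ b := by
  rw [E_avg ⟨0, hc⟩ (q ⟨0, hc⟩)]
  have : ∀ T : Tab c b A,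
      (∑ u, ind (binVal (tabHash (sh ⟨0, hc⟩ (q ⟨0, hc⟩) u T) q) = v)) / 2 ^ b
      = (1 : ℝ) / 2 ^ b := by
    intro T
    simp only [hash_sh_of_eq _ T rfl, sum_eq_shift v hv]
  simp only [this, E_const]

lemma E_qxy (hc : 1 ≤ c) (q x y : Fin c → A) (hxy : x ≠ y) (v k : ℕ) (hv : v < 2 ^ b)
    (hk : k ≤ b) :
    E (fun T : Tab c b A => ind (binVal (tabHash T q) = v) *
      ind (binVal (tabHash T x + tabHash T y) < 2 ^ k)) = 1 / 2 ^ b * (2 ^ k / 2 ^ b) := by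
  obtain ⟨j, hj⟩ := Function.ne_iff.mp hxy
  wlog hqx : x j ≠ q j generalizing x y
  · have := this y x hxy.symm hj.symm (by push Not at hqx; rw [← hqx]; exact hj.symm)
    rw [← this]; congr 1; funext T; rw [add_comm]
  rw [E_avg_mul j (x j) (fun T : Tab c b A => ind (binVal (tabHash T q) = v))
    (fun T => ind (binVal (tabHash T x + tabHash T y) < 2 ^ k))]
  · have : ∀ T : Tab c b A,
      (∑ u, ind (binVal (tabHash (sh j (x j) u T) x + tabHash (sh j (x j) u T) y) < 2 ^ k)) / 2 ^ b
        = (2 : ℝ) ^ k / 2 ^ b := by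
      intro T
      simp only [hash_sh_of_eq _ T rfl, hash_sh_of_ne _ T hj.symm, add_right_comm _ _ (tabHash T y)]
      rw [sum_low_shift _ (Nat.pow_le_pow_right (by norm_num) hk)]
      push_cast; rfl
    simp only [this]
    rw [← E_q hc q v hv, mul_comm, ← E_mul]
    congr 1; funext T; ring
  · intro u T
    simp only [hash_sh_of_ne _ T hqx.symm]

lemma main_lower (hc : 1 ≤ c) (q : Fin c → A) (n : ℕ) (v : ℕ) (hv : v < 2 ^ b) (ε p : ℝ)
    (hp : p = (v + 1 : ℕ) / 2 ^ b) (hε : 2 * (n : ℝ) ^ (1 - 1 / (c : ℝ)) * p ≤ ε) (hε1 : ε < 1) :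
    ∀ B : Finset (Fin c → A), q ∉ B → B.card ≤ n →
    1 / 2 ^ b * Real.exp (-(p / (1 - ε) * B.card)) ≤
    E (fun T : Tab c b A => ind (binVal (tabHash T q) = v) * ind (Miss T B (v + 1))) := by
  have hp0 : 0 ≤ p := by rw [hp]; positivity
  refine peel_induct hc q n (P := fun B => 1 / 2 ^ b * Real.exp (-(p / (1 - ε) * B.card)) ≤
    E (fun T : Tab c b A => ind (binVal (tabHash T q) = v) * ind (Miss T B (v + 1)))) ?_ ?_
  · have : ∀ T : Tab c b A, ind (Miss T ∅ (v + 1)) = 1 := fun T => ind_true (by simp [Miss])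
    simp only [this, mul_one, E_q hc q v hv]
    simp
  · intro B j a hne hG ih
    set G := B.filter (fun x => x j = a) with hGdef
    set B' := B.filter (fun x => x j ≠ a) with hB'def
    have hcs : (B.card : ℝ) = G.card + B'.card := card_split B j a
    rw [step_eq j a (fun T => ind (binVal (tabHash T q) = v))
      (fun u T => by simp only [hash_sh_of_ne _ T hne.symm])]
    have hx : (G.card : ℝ) * p ≤ ε := (mul_le_mul_of_nonneg_right hG hp0).trans hε
    have hx0 : 0 ≤ (G.card : ℝ) * p := by positivity
    have h1 : (1 - G.card * p) *
        E (fun T : Tab c b A => ind (binVal (tabHash T q) = v) * ind (Miss T B' (v + 1))) ≤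
        E (fun T : Tab c b A => ind (binVal (tabHash T q) = v) * ind (Miss T B' (v + 1)) *
          ((∑ u, ind (Miss (sh j a u T) G (v + 1))) / 2 ^ b)) := by
      rw [← E_mul]
      apply E_mono
      intro T
      rw [mul_comm]
      apply mul_le_mul_of_nonneg_left _ (mul_nonneg (ind_nonneg _) (ind_nonneg _))
      simp only [hGdef, miss_sh_iff]
      have := avg_lower G T (v + 1) hv
      rw [← hp] at this
      exact this
    refine le_trans ?_ h1
    have h2 : Real.exp (-(p / (1 - ε) * G.card)) ≤ 1 - G.card * p := by
      have h3 : (1 - (G.card : ℝ) * p)⁻¹ ≤ Real.exp (p / (1 - ε) * G.card) := by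
        have h4 := Real.add_one_le_exp (p / (1 - ε) * G.card)
        refine le_trans ?_ h4
        have h5 : (1 - (G.card : ℝ) * p)⁻¹ = G.card * p / (1 - G.card * p) + 1 := by
          have : 1 - (G.card : ℝ) * p ≠ 0 := by linarith
          field_simp; ring
        rw [h5]
        have : G.card * p / (1 - G.card * p) ≤ G.card * p / (1 - ε) :=
          div_le_div_of_nonneg_left hx0 (by linarith) (by linarith)
        have h6 : p / (1 - ε) * G.card = G.card * p / (1 - ε) := by ring
        rw [h6]; linarith
      rw [Real.exp_neg]
      exact inv_le_of_inv_le₀ (by linarith) h3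
    have h7 : Real.exp (-(p / (1 - ε) * B.card)) =
        Real.exp (-(p / (1 - ε) * G.card)) * Real.exp (-(p / (1 - ε) * B'.card)) := by
      rw [← Real.exp_add, hcs]; congr 1; ring
    rw [h7]
    calc _ = Real.exp (-(p / (1 - ε) * G.card)) *
          (1 / 2 ^ b * Real.exp (-(p / (1 - ε) * B'.card))) := by ring
      _ ≤ _ := mul_le_mul h2 ih (by positivity) (by linarith)

lemma main_upper (hc : 1 ≤ c) (q : Fin c → A) (n : ℕ) (v : ℕ) (hv : v < 2 ^ b) (L p : ℝ)
    (hp : p = (v + 1 : ℕ) / 2 ^ b) (hL : L = 2 * (n : ℝ) ^ (1 - 1 / (c : ℝ))) :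
    ∀ B : Finset (Fin c → A), q ∉ B → B.card ≤ n →
    E (fun T : Tab c b A => ind (binVal (tabHash T q) = v) * ind (Miss T B (v + 1))) ≤
    1 / 2 ^ b * (Real.exp (-(p * B.card)) + 2 * p * L) := by
  have hp0 : 0 ≤ p := by rw [hp]; positivity
  have hL0 : 0 ≤ L := by rw [hL]; positivity
  have htriv : ∀ B : Finset (Fin c → A),
      E (fun T : Tab c b A => ind (binVal (tabHash T q) = v) * ind (Miss T B (v + 1))) ≤
      1 / 2 ^ b := by
    intro B
    rw [← E_q hc q v hv]
    apply E_mono; intro T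
    exact mul_le_of_le_one_right (ind_nonneg _) (ind_le_one _)
  by_cases hpL : 1 ≤ p * L
  · intro B _ _
    refine (htriv B).trans ?_
    apply le_mul_of_one_le_right (by positivity)
    have := Real.exp_pos (-(p * B.card))
    nlinarith
  push Not at hpL
  refine peel_induct hc q n (P := fun B =>
    E (fun T : Tab c b A => ind (binVal (tabHash T q) = v) * ind (Miss T B (v + 1))) ≤
    1 / 2 ^ b * (Real.exp (-(p * B.card)) + 2 * p * L)) ?_ ?_
  · refine (htriv ∅).trans ?_
    apply le_mul_of_one_le_right (by positivity)
    simp; positivity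
  · intro B j a hne hG ih
    rw [← hL] at hG
    set G := B.filter (fun x => x j = a) with hGdef
    set B' := B.filter (fun x => x j ≠ a) with hB'def
    have hcs : (B.card : ℝ) = G.card + B'.card := card_split B j a
    rw [step_eq j a (fun T => ind (binVal (tabHash T q) = v))
      (fun u T => by simp only [hash_sh_of_ne _ T hne.symm])]
    have hx0 : 0 ≤ (G.card : ℝ) * p := by positivity
    have hx1 : (G.card : ℝ) * p ≤ 1 := by nlinarith
    obtain ⟨k, hkb, htk, hk2⟩ : ∃ k, k ≤ b ∧ v + 1 ≤ 2 ^ k ∧ 2 ^ k ≤ 2 * (v + 1) := by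
      refine ⟨Nat.clog 2 (v + 1), Nat.clog_le_of_le_pow hv, Nat.le_pow_clog (by norm_num) _, ?_⟩
      rcases Nat.eq_zero_or_pos v with h | h
      · subst h; simp
      · have h1 := Nat.pow_pred_clog_lt_self (b := 2) (by norm_num) (x := v + 1) (by omega)
        have h2 : 0 < Nat.clog 2 (v + 1) := Nat.clog_pos (by norm_num) (by omega)
        obtain ⟨m, hm⟩ := Nat.exists_eq_succ_of_ne_zero h2.ne'
        rw [hm] at h1 ⊢
        simp only [Nat.succ_eq_add_one, Nat.pred_eq_sub_one, Nat.add_sub_cancel] at h1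
        rw [Nat.succ_eq_add_one, pow_succ]; omega
    have hkp : (2 : ℝ) ^ k / 2 ^ b ≤ 2 * p := by
      rw [hp, ← mul_div_assoc]
      gcongr
      exact_mod_cast hk2
    have h1 : E (fun T : Tab c b A => ind (binVal (tabHash T q) = v) * ind (Miss T B' (v + 1)) *
          ((∑ u, ind (Miss (sh j a u T) G (v + 1))) / 2 ^ b)) ≤
        (1 - G.card * p) *
        E (fun T : Tab c b A => ind (binVal (tabHash T q) = v) * ind (Miss T B' (v + 1))) +
        p * ∑ x ∈ G, ∑ y ∈ G.erase x, E (fun T : Tab c b A => ind (binVal (tabHash T q) = v) *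
          ind (binVal (tabHash T x + tabHash T y) < 2 ^ k)) := by
      simp only [← E_sum]
      rw [← E_mul, ← E_mul, ← E_add]
      apply E_mono
      intro T
      have h2 := avg_upper G T (v + 1) k hv htk
      rw [← hp] at h2
      simp only [hGdef, miss_sh_iff]
      simp only [← hGdef]
      simp only [← Finset.mul_sum]
      set X := ∑ x ∈ G, ∑ y ∈ G.erase x, ind (binVal (tabHash T x + tabHash T y) < 2 ^ k) with hX
      have hX0 : 0 ≤ X :=
        Finset.sum_nonneg (fun x _ => Finset.sum_nonneg (fun y _ => ind_nonneg _))
      set Q := ind (binVal (tabHash T q) = v)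
      set I := ind (Miss T B' (v + 1))
      have hQ : 0 ≤ Q := ind_nonneg _
      have hI : 0 ≤ I := ind_nonneg _
      have hI1 : I ≤ 1 := ind_le_one _
      calc _ ≤ Q * I * (1 - G.card * p + p * X) :=
            mul_le_mul_of_nonneg_left h2 (mul_nonneg hQ hI)
        _ = (1 - G.card * p) * (Q * I) + (Q * (p * X)) * I := by ring
        _ ≤ (1 - G.card * p) * (Q * I) + (Q * (p * X)) * 1 := by gcongr
        _ = _ := by ring
    refine h1.trans ?_
    have h3 : ∑ x ∈ G, ∑ y ∈ G.erase x, E (fun T : Tab c b A => ind (binVal (tabHash T q) = v) *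
          ind (binVal (tabHash T x + tabHash T y) < 2 ^ k)) ≤
          1 / 2 ^ b * (2 * p * (G.card * G.card)) := by
      have h4 : ∀ x ∈ G, ∑ y ∈ G.erase x, E (fun T : Tab c b A => ind (binVal (tabHash T q) = v) *
          ind (binVal (tabHash T x + tabHash T y) < 2 ^ k)) ≤
          G.card * (1 / 2 ^ b * (2 * p)) := by
        intro x _
        have : ∀ y ∈ G.erase x, E (fun T : Tab c b A => ind (binVal (tabHash T q) = v) *
          ind (binVal (tabHash T x + tabHash T y) < 2 ^ k)) ≤ 1 / 2 ^ b * (2 * p) := by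
          intro y hy
          rw [E_qxy hc q x y (Finset.ne_of_mem_erase hy).symm v k hv hkb]
          gcongr
        refine (Finset.sum_le_sum this).trans ?_
        rw [Finset.sum_const, nsmul_eq_mul]
        gcongr
        exact Finset.erase_subset _ _
      refine (Finset.sum_le_sum h4).trans (le_of_eq ?_)
      rw [Finset.sum_const, nsmul_eq_mul]; ring
    have h5 : 1 - (G.card : ℝ) * p ≤ Real.exp (-(p * G.card)) := by
      have := Real.add_one_le_exp (-(p * G.card)); linarith
    have h6 : Real.exp (-(p * B.card)) = Real.exp (-(p * G.card)) * Real.exp (-(p * B'.card)) := by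
      rw [← Real.exp_add, hcs]; congr 1; ring
    calc _ ≤ (1 - G.card * p) * (1 / 2 ^ b * (Real.exp (-(p * B'.card)) + 2 * p * L)) +
          p * (1 / 2 ^ b * (2 * p * (G.card * G.card))) := by
          have : 0 ≤ 1 - (G.card : ℝ) * p := by linarith
          gcongr
      _ = 1 / 2 ^ b * ((1 - G.card * p) * Real.exp (-(p * B'.card)) + 2 * p * L -
          2 * p * (p * G.card) * (L - G.card)) := by ring
      _ ≤ 1 / 2 ^ b * (Real.exp (-(p * G.card)) * Real.exp (-(p * B'.card)) + 2 * p * L - 0) := by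
          have : 0 ≤ 2 * p * (p * G.card) * (L - G.card) :=
            mul_nonneg (by positivity) (by linarith)
          gcongr
      _ = _ := by rw [h6]; ring

end


section
variable {c b : ℕ} {A : Type} [Fintype A] [DecidableEq A]

def Chain : List (Fin c → A) → Prop
  | [] => True
  | x :: l => (∃ i, ∀ y ∈ l, y i ≠ x i) ∧ Chain l

def Col (k : ℕ) (T : Tab c b A) (l : List (Fin c → A)) : Prop :=
  ∀ x ∈ l, ∀ y ∈ l, binVal (tabHash T x + tabHash T y) < 2 ^ k

lemma exists_chain (hc : 1 ≤ c) (s : ℕ) : ∀ X : Finset (Fin c → A), 2 ^ s ≤ X.card →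
    ∃ l : List (Fin c → A), l.length = s + 1 ∧ Chain l ∧ ∀ x ∈ l, x ∈ X := by
  induction s with
  | zero =>
    intro X hX
    obtain ⟨x, hx⟩ := Finset.card_pos.mp (show 0 < X.card by simpa using hX)
    exact ⟨[x], by simp, ⟨⟨⟨0, hc⟩, by simp⟩, trivial⟩, by simpa using hx⟩
  | succ s ih =>
    intro X hX
    have hs : 1 ≤ 2 ^ s := Nat.one_le_two_pow
    rw [pow_succ] at hX
    obtain ⟨x, hx, y, hy, hxy⟩ := Finset.one_lt_card.mp (show 1 < X.card by omega)
    obtain ⟨i, hi⟩ := Function.ne_iff.mp hxy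
    have hsplit := Finset.card_filter_add_card_filter_not (s := X) (fun z => z i = x i)
    by_cases h : 2 ^ s ≤ (X.filter (fun z => ¬ z i = x i)).card
    · obtain ⟨l, h1, h2, h3⟩ := ih _ h
      refine ⟨x :: l, by simp [h1], ⟨⟨i, fun z hz => (Finset.mem_filter.mp (h3 z hz)).2⟩, h2⟩, ?_⟩
      intro z hz
      rcases List.mem_cons.mp hz with rfl | hz
      · exact hx
      · exact (Finset.mem_filter.mp (h3 z hz)).1
    · obtain ⟨l, h1, h2, h3⟩ := ih (X.filter (fun z => z i = x i)) (by omega)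
      refine ⟨y :: l, by simp [h1],
        ⟨⟨i, fun z hz => by rw [(Finset.mem_filter.mp (h3 z hz)).2]; exact hi⟩, h2⟩, ?_⟩
      intro z hz
      rcases List.mem_cons.mp hz with rfl | hz
      · exact hy
      · exact (Finset.mem_filter.mp (h3 z hz)).1

lemma E_col (k : ℕ) (hk : k ≤ b) (s : ℕ) : ∀ l : List (Fin c → A), l.length = s + 1 → Chain l →
    E (fun T : Tab c b A => ind (Col k T l)) ≤ ((2 : ℝ) ^ k / 2 ^ b) ^ s := by
  induction s with
  | zero =>
    intro l _ _
    rw [pow_zero, ← E_const (c := c) (b := b) (A := A) 1]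
    exact E_mono (fun T => ind_le_one _)
  | succ s ih =>
    intro l hl hch
    match l, hl, hch with
    | x :: y :: l, hl, hch =>
      obtain ⟨⟨i, hi⟩, hch'⟩ := hch
      have h1 := ih (y :: l) (by simpa using hl) hch'
      have h2 : E (fun T : Tab c b A => ind (Col k T (x :: y :: l))) ≤
          E (fun T : Tab c b A => ind (Col k T (y :: l)) *
            ind (binVal (tabHash T x + tabHash T y) < 2 ^ k)) := by
        apply E_mono; intro T
        rw [← ind_and]
        apply ind_mono
        intro h
        exact ⟨fun z hz z' hz' => h z (List.mem_cons_of_mem _ hz) z' (List.mem_cons_of_mem _ hz'),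
          h x (by simp) y (by simp)⟩
      refine h2.trans ?_
      rw [E_avg_mul i (x i)]
      · have : ∀ T : Tab c b A,
          (∑ u, ind (binVal (tabHash (sh i (x i) u T) x + tabHash (sh i (x i) u T) y) < 2 ^ k))
            / 2 ^ b = (2 : ℝ) ^ k / 2 ^ b := by
          intro T
          simp only [hash_sh_of_eq _ T rfl, hash_sh_of_ne _ T (hi y (by simp)),
            add_right_comm _ _ (tabHash T y)]
          rw [sum_low_shift _ (Nat.pow_le_pow_right (by norm_num) hk)]
          push_cast; rfl
        simp only [this]
        have h3 : E (fun T : Tab c b A => ind (Col k T (y :: l)) * ((2 : ℝ) ^ k / 2 ^ b)) =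
            ((2 : ℝ) ^ k / 2 ^ b) * E (fun T : Tab c b A => ind (Col k T (y :: l))) := by
          rw [← E_mul]; congr 1; funext T; ring
        rw [h3, pow_succ, mul_comm]
        gcongr
      · intro u T
        apply ind_congr
        unfold Col
        constructor
        · intro h z hz z' hz'
          have := h z hz z' hz'
          rwa [hash_sh_of_ne _ T (hi z hz), hash_sh_of_ne _ T (hi z' hz')] at this
        · intro h z hz z' hz'
          rw [hash_sh_of_ne _ T (hi z hz), hash_sh_of_ne _ T (hi z' hz')]
          exact h z hz z' hz'

def Bad (k s : ℕ) (G : Finset (Fin c → A)) (T : Tab c b A) : Prop :=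
  ∃ X ⊆ G, 2 ^ s ≤ X.card ∧ ∀ x ∈ X, ∀ y ∈ X, binVal (tabHash T x + tabHash T y) < 2 ^ k

lemma E_bad (hc : 1 ≤ c) (k s : ℕ) (hk : k ≤ b) (G : Finset (Fin c → A)) :
    E (fun T : Tab c b A => ind (Bad k s G T)) ≤
      (G.card : ℝ) ^ (s + 1) * ((2 : ℝ) ^ k / 2 ^ b) ^ s := by
  let Fs := Fintype.piFinset (fun _ : Fin (s + 1) => G)
  have h1 : E (fun T : Tab c b A => ind (Bad k s G T)) ≤
      ∑ f ∈ Fs, E (fun T : Tab c b A => ind (Chain (List.ofFn f) ∧ Col k T (List.ofFn f))) := by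
    rw [← E_sum]
    apply E_mono; intro T
    apply ind_exists_le
    rintro ⟨X, hXG, hX, hlow⟩
    obtain ⟨l, hl, hch, hlX⟩ := exists_chain hc s X hX
    obtain ⟨f, rfl⟩ : ∃ f : Fin (s + 1) → (Fin c → A), List.ofFn f = l := by
      rw [← hl]
      exact ⟨l.get, List.ofFn_get l⟩
    refine ⟨f, ?_, hch, fun x hx y hy => hlow x (hlX x hx) y (hlX y hy)⟩
    rw [Fintype.mem_piFinset]
    intro i
    exact hXG (hlX _ ((List.mem_ofFn' _ _).mpr ⟨i, rfl⟩))
  refine h1.trans ?_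
  have h2 : ∀ f ∈ Fs, E (fun T : Tab c b A => ind (Chain (List.ofFn f) ∧ Col k T (List.ofFn f))) ≤
      ((2 : ℝ) ^ k / 2 ^ b) ^ s := by
    intro f _
    by_cases hch : Chain (List.ofFn f)
    · refine le_trans (E_mono fun T => ind_mono fun h => h.2) (E_col k hk s _ (by simp) hch)
    · have : ∀ T : Tab c b A, ind (Chain (List.ofFn f) ∧ Col k T (List.ofFn f)) = 0 :=
        fun T => ind_false (fun h => hch h.1)
      simp only [this, E_const]; positivity
  refine (Finset.sum_le_sum h2).trans (le_of_eq ?_)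
  rw [Finset.sum_const, nsmul_eq_mul, Fintype.card_piFinset]
  simp

lemma avg_tail (G : Finset (Fin c → A)) (T : Tab c b A) (k s : ℕ) (hk : k ≤ b) :
    (∑ u, ind (∀ x ∈ G, ¬ binVal (tabHash T x + u) < 2 ^ k)) / 2 ^ b ≤
    1 - (G.card : ℝ) * ((2 : ℝ) ^ k / 2 ^ b) / 2 ^ s +
      (G.card : ℝ) * ((2 : ℝ) ^ k / 2 ^ b) / 2 ^ s * ind (Bad k s G T) := by
  have hkb : (2 : ℕ) ^ k ≤ 2 ^ b := Nat.pow_le_pow_right (by norm_num) hk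
  rw [div_le_iff₀ (by positivity)]
  by_cases hbad : Bad k s G T
  · rw [ind_true hbad]
    have h1 := Finset.sum_le_sum (fun u (_ : u ∈ Finset.univ) =>
      ind_le_one (∀ x ∈ G, ¬ binVal (tabHash T x + u) < 2 ^ k))
    rw [Finset.sum_const, Finset.card_univ, nsmul_eq_mul, card_V] at h1
    linarith
  · rw [ind_false hbad]
    have h1 : ∀ u : Fin b → ZMod 2, ind (∀ x ∈ G, ¬ binVal (tabHash T x + u) < 2 ^ k) ≤
        1 - (1 / 2 ^ s) * ∑ x ∈ G, ind (binVal (tabHash T x + u) < 2 ^ k) := by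
      intro u
      by_cases hm : ∀ x ∈ G, ¬ binVal (tabHash T x + u) < 2 ^ k
      · rw [ind_true hm, Finset.sum_eq_zero (fun x hx => ind_false (hm x hx))]
        simp
      · rw [ind_false hm, sum_ind_eq_card]
        have h2 : (G.filter (fun x => binVal (tabHash T x + u) < 2 ^ k)).card < 2 ^ s := by
          by_contra hge
          push Not at hge
          apply hbad
          refine ⟨_, Finset.filter_subset _ _, hge, ?_⟩
          intro x hx y hy
          have := low_add (Finset.mem_filter.mp hx).2 (Finset.mem_filter.mp hy).2
          have he : tabHash T x + u + (tabHash T y + u) = tabHash T x + tabHash T y := by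
            rw [add_add_add_comm, V_add_self, add_zero]
          rwa [he] at this
        have h3 : ((G.filter (fun x => binVal (tabHash T x + u) < 2 ^ k)).card : ℝ) ≤ 2 ^ s := by
          exact_mod_cast h2.le
        rw [sub_nonneg, one_div, inv_mul_le_iff₀ (by positivity)]
        linarith
    have h2 := Finset.sum_le_sum (fun u (_ : u ∈ Finset.univ) => h1 u)
    rw [Finset.sum_sub_distrib, ← Finset.mul_sum, sum_hits G T _ hkb, Finset.sum_const,
      Finset.card_univ, nsmul_eq_mul, card_V] at h2
    refine h2.trans (le_of_eq ?_)
    push_cast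
    field_simp
    ring

lemma tail_bound (hc : 1 ≤ c) (q : Fin c → A) (n k s : ℕ) (hk : k ≤ b) (L p : ℝ)
    (hp : p = 2 ^ k / 2 ^ b) (hL : L = 2 * (n : ℝ) ^ (1 - 1 / (c : ℝ))) :
    ∀ B : Finset (Fin c → A), q ∉ B → B.card ≤ n →
    E (fun T : Tab c b A => ind (Miss T B (2 ^ k))) ≤
    Real.exp (-(p / 2 ^ s * B.card)) + B.card * (L * p) ^ s := by
  have hp0 : 0 ≤ p := by rw [hp]; positivity
  have hL0 : 0 ≤ L := by rw [hL]; positivity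
  have htriv : ∀ B : Finset (Fin c → A), E (fun T : Tab c b A => ind (Miss T B (2 ^ k))) ≤ 1 := by
    intro B
    rw [← E_const (c := c) (b := b) (A := A) 1]
    exact E_mono fun T => ind_le_one _
  by_cases hpL : 1 ≤ L * p
  · intro B _ _
    refine (htriv B).trans ?_
    rcases B.eq_empty_or_nonempty with rfl | hB
    · simp
    · have h1 : (1 : ℝ) ≤ B.card := by exact_mod_cast hB.card_pos
      have h2 : 1 ≤ (L * p) ^ s := one_le_pow₀ hpL
      have := Real.exp_pos (-(p / 2 ^ s * B.card))
      nlinarith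
  push Not at hpL
  refine peel_induct hc q n (P := fun B => E (fun T : Tab c b A => ind (Miss T B (2 ^ k))) ≤
    Real.exp (-(p / 2 ^ s * B.card)) + B.card * (L * p) ^ s) ?_ ?_
  · refine (htriv ∅).trans ?_
    simp
  · intro B j a hne hG ih
    rw [← hL] at hG
    set G := B.filter (fun x => x j = a) with hGdef
    set B' := B.filter (fun x => x j ≠ a) with hB'def
    have hcs : (B.card : ℝ) = G.card + B'.card := card_split B j a
    have h0 := step_eq (b := b) j a (fun T => (1 : ℝ)) (fun u T => rfl) B (2 ^ k)
    simp only [one_mul] at h0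
    rw [h0]
    set x : ℝ := G.card * p / 2 ^ s with hx
    have hx0 : 0 ≤ x := by positivity
    have hgp : (G.card : ℝ) * p ≤ L * p := by gcongr
    have hx1 : x ≤ 1 := by
      rw [hx, div_le_one (by positivity)]
      have : (1 : ℝ) ≤ 2 ^ s := one_le_pow₀ (by norm_num)
      linarith
    have h1 : E (fun T : Tab c b A => ind (Miss T B' (2 ^ k)) *
          ((∑ u, ind (Miss (sh j a u T) G (2 ^ k))) / 2 ^ b)) ≤
        (1 - x) * E (fun T : Tab c b A => ind (Miss T B' (2 ^ k))) +
        E (fun T : Tab c b A => ind (Bad k s G T)) := by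
      rw [← E_mul, ← E_add]
      apply E_mono
      intro T
      have h2 := avg_tail G T k s hk
      rw [← hp, ← hx] at h2
      simp only [hGdef, miss_sh_iff]
      simp only [← hGdef]
      set I := ind (Miss T B' (2 ^ k))
      set D := ind (Bad k s G T)
      have hI : 0 ≤ I := ind_nonneg _
      have hI1 : I ≤ 1 := ind_le_one _
      have hD : 0 ≤ D := ind_nonneg _
      calc _ ≤ I * (1 - x + x * D) := mul_le_mul_of_nonneg_left h2 hI
        _ = (1 - x) * I + (I * x) * D := by ring
        _ ≤ (1 - x) * I + 1 * D := by
          have : I * x ≤ 1 := mul_le_one₀ hI1 hx0 hx1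
          gcongr
        _ = _ := by ring
    refine h1.trans ?_
    have h3 : E (fun T : Tab c b A => ind (Bad k s G T)) ≤ G.card * (L * p) ^ s := by
      refine (E_bad hc k s hk G).trans ?_
      rw [← hp, pow_succ, mul_right_comm, ← mul_pow, mul_comm]
      gcongr
    have h5 : 1 - x ≤ Real.exp (-(p / 2 ^ s * G.card)) := by
      have := Real.add_one_le_exp (-(p / 2 ^ s * G.card))
      have h : p / 2 ^ s * G.card = x := by rw [hx]; ring
      rw [h] at this ⊢
      linarith
    have h6 : Real.exp (-(p / 2 ^ s * B.card)) =
        Real.exp (-(p / 2 ^ s * G.card)) * Real.exp (-(p / 2 ^ s * B'.card)) := by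
      rw [← Real.exp_add, hcs]; congr 1; ring
    have hLp : 0 ≤ (L * p) ^ s := by positivity
    calc _ ≤ (1 - x) * (Real.exp (-(p / 2 ^ s * B'.card)) + B'.card * (L * p) ^ s) +
          G.card * (L * p) ^ s := by
          have : 0 ≤ 1 - x := by linarith
          gcongr
      _ = (1 - x) * Real.exp (-(p / 2 ^ s * B'.card)) + (1 - x) * (B'.card * (L * p) ^ s) +
          G.card * (L * p) ^ s := by ring
      _ ≤ Real.exp (-(p / 2 ^ s * G.card)) * Real.exp (-(p / 2 ^ s * B'.card)) +
          1 * (B'.card * (L * p) ^ s) + G.card * (L * p) ^ s := by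
          gcongr
          linarith
      _ = _ := by rw [h6, hcs]; ring

end


lemma geo_sum (β : ℝ) (M : ℕ) :
    (∑ v ∈ range M, Real.exp (-(β * (v + 1 : ℕ)))) * (Real.exp β - 1) = 1 - Real.exp (-(β * M)) := by
  induction M with
  | zero => simp
  | succ M ih =>
    rw [Finset.sum_range_succ, add_mul, ih]
    have h : Real.exp (-(β * (M : ℕ))) = Real.exp (-(β * (M + 1 : ℕ))) * Real.exp β := by
      rw [← Real.exp_add]; congr 1; push_cast; ring
    rw [h]; ring

lemma geo_upper (β : ℝ) (hβ : 0 < β) (M : ℕ) :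
    ∑ v ∈ range M, Real.exp (-(β * (v + 1 : ℕ))) ≤ 1 / β := by
  have h := geo_sum β M
  have h1 := Real.add_one_le_exp β
  have h2 := Real.exp_pos (-(β * M))
  have h3 : 0 ≤ ∑ v ∈ range M, Real.exp (-(β * (v + 1 : ℕ))) :=
    Finset.sum_nonneg fun _ _ => (Real.exp_pos _).le
  rw [le_div_iff₀ hβ]
  nlinarith

lemma geo_lower (β : ℝ) (hβ : 0 < β) (M : ℕ) :
    1 / β - 1 - 1 / β * Real.exp (-(β * M)) ≤ ∑ v ∈ range M, Real.exp (-(β * (v + 1 : ℕ))) := by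
  have h := geo_sum β M
  have h1 := Real.add_one_le_exp β
  have h2 := Real.exp_pos (-(β * M))
  set Y := Real.exp β - 1 with hY
  have hY0 : 0 < Y := by linarith
  have hs : ∑ v ∈ range M, Real.exp (-(β * (v + 1 : ℕ))) = 1 / Y - 1 / Y * Real.exp (-(β * M)) := by
    rw [eq_comm, ← mul_one_sub, one_div, inv_mul_eq_iff_eq_mul₀ hY0.ne', ← h, mul_comm]
  rw [hs]
  have h3 : 1 / Y ≤ 1 / β := one_div_le_one_div_of_le hβ (by linarith)
  have h4 : 1 / β - 1 ≤ 1 / Y := by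
    have h5 : Y ≤ β * (Y + 1) := by
      have h6 := Real.add_one_le_exp (-β)
      have h7 : Real.exp (-β) * (Y + 1) = 1 := by
        rw [hY, sub_add_cancel, ← Real.exp_add]; simp
      nlinarith
    rw [sub_le_iff_le_add, div_le_iff₀ hβ]
    have : (1 / Y + 1) * β = β * (Y + 1) / Y := by field_simp; ring
    rw [this, le_div_iff₀ hY0]; linarith
  have : 1 / Y * Real.exp (-(β * M)) ≤ 1 / β * Real.exp (-(β * M)) := by gcongr
  linarith

lemma choose_k (w : ℕ) (t : ℝ) (ht : 1 ≤ 2 * (t * 2 ^ w)) :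
    ∃ k, k ≤ w ∧ (2 : ℝ) ^ k / 2 ^ w ≤ 2 * t ∧ (k = w ∨ t ≤ (2 : ℝ) ^ k / 2 ^ w) := by
  classical
  have hex : ∃ k, k = w ∨ t * 2 ^ w ≤ (2 : ℝ) ^ k := ⟨w, Or.inl rfl⟩
  have h1 := Nat.find_spec hex
  have hle : Nat.find hex ≤ w := Nat.find_min' hex (Or.inl rfl)
  have hmin := fun m => Nat.find_min hex (m := m)
  generalize Nat.find hex = k at h1 hle hmin
  refine ⟨k, hle, ?_, ?_⟩
  · rw [div_le_iff₀ (by positivity), mul_assoc]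
    rcases k with _ | k
    · simpa using ht
    · have := hmin k (by omega)
      push Not at this
      rw [pow_succ]; linarith [this.2]
  · refine h1.imp id fun h => ?_
    rwa [le_div_iff₀ (by positivity)]

section
variable {c b : ℕ} {A : Type} [Fintype A] [DecidableEq A]

lemma pr_lower (S : Finset (Fin c → A)) (q : Fin c → A) (M : ℕ) :
    ∑ v ∈ range M, E (fun T : Tab c b A => ind (binVal (tabHash T q) = v) * ind (Miss T S (v + 1)))
    ≤ E (fun T : Tab c b A => ind (∀ x ∈ S, binVal (tabHash T q) < binVal (tabHash T x))) := by
  rw [← E_sum]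
  apply E_mono
  intro T
  have h : ∀ v ∈ range M, ind (binVal (tabHash T q) = v) * ind (Miss T S (v + 1)) ≤
      if binVal (tabHash T q) = v then
        ind (∀ x ∈ S, binVal (tabHash T q) < binVal (tabHash T x)) else 0 := by
    intro v _
    rw [← ind_and]
    split_ifs with hv
    · apply ind_mono
      rintro ⟨_, h⟩ x hx
      have := h x hx
      omega
    · rw [ind_false (fun h => hv h.1)]
  refine (Finset.sum_le_sum h).trans ?_
  rw [Finset.sum_ite_eq]
  split_ifs
  · exact le_rfl
  · exact ind_nonneg _

lemma pr_upper (S : Finset (Fin c → A)) (q : Fin c → A) (M : ℕ) :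
    E (fun T : Tab c b A => ind (∀ x ∈ S, binVal (tabHash T q) < binVal (tabHash T x))) ≤
    ∑ v ∈ range M, E (fun T : Tab c b A => ind (binVal (tabHash T q) = v) * ind (Miss T S (v + 1)))
    + E (fun T : Tab c b A => ind (M ≤ binVal (tabHash T q) ∧ Miss T S M)) := by
  rw [← E_sum, ← E_add]
  apply E_mono
  intro T
  by_cases h : ∀ x ∈ S, binVal (tabHash T q) < binVal (tabHash T x)
  · have h0 : ∀ v ∈ range M, 0 ≤ ind (binVal (tabHash T q) = v) * ind (Miss T S (v + 1)) :=
      fun v _ => mul_nonneg (ind_nonneg _) (ind_nonneg _)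
    rw [ind_true h]
    by_cases hM : binVal (tabHash T q) < M
    · have h1 := Finset.single_le_sum h0 (Finset.mem_range.mpr hM)
      rw [← ind_and, ind_true] at h1
      · have := ind_nonneg (M ≤ binVal (tabHash T q) ∧ Miss T S M)
        linarith
      · exact ⟨rfl, fun x hx => by have := h x hx; omega⟩
    · rw [ind_true (P := M ≤ binVal (tabHash T q) ∧ Miss T S M)]
      · have := Finset.sum_nonneg h0
        linarith
      · push Not at hM
        exact ⟨hM, fun x hx => by have := h x hx; omega⟩
  · rw [ind_false h]
    exact add_nonneg (Finset.sum_nonneg fun v _ => mul_nonneg (ind_nonneg _) (ind_nonneg _))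
      (ind_nonneg _)

lemma final_lower (hc : 1 ≤ c) (S : Finset (Fin c → A)) (q : Fin c → A) (hq : q ∉ S)
    (hS : 2 ≤ S.card) (k : ℕ) (hk : k ≤ b) (L p : ℝ) (hp : p = 2 ^ k / 2 ^ b)
    (hL : L = 2 * (S.card : ℝ) ^ (1 - 1 / (c : ℝ)))
    (hnp : Real.log S.card ≤ S.card * p) :
    1 / (S.card : ℝ) - (L * p / S.card + 1 / 2 ^ b + 1 / (S.card : ℝ) ^ 2) ≤
    E (fun T : Tab c b A => ind (∀ x ∈ S, binVal (tabHash T q) < binVal (tabHash T x))) := by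
  have hn2 : (2 : ℝ) ≤ S.card := by exact_mod_cast hS
  set n : ℝ := (S.card : ℝ) with hn
  have hn0 : 0 < n := by linarith
  have hp0 : 0 < p := by rw [hp]; positivity
  have hL0 : 0 ≤ L := by rw [hL]; positivity
  set ε := L * p with hε
  have hε0 : 0 ≤ ε := by positivity
  by_cases hε1 : 1 ≤ ε
  · have h1 : 0 ≤ E (fun T : Tab c b A =>
      ind (∀ x ∈ S, binVal (tabHash T q) < binVal (tabHash T x))) := E_nonneg fun T => ind_nonneg _
    refine le_trans ?_ h1
    have h2 : 1 / n ≤ ε / n := by gcongr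
    have h3 : (0 : ℝ) ≤ 1 / 2 ^ b := by positivity
    have h4 : 0 ≤ 1 / n ^ 2 := by positivity
    linarith
  push Not at hε1
  refine le_trans ?_ (pr_lower S q (2 ^ k))
  have hkb : (2 : ℕ) ^ k ≤ 2 ^ b := Nat.pow_le_pow_right (by norm_num) hk
  have h1ε : 0 < 1 - ε := by linarith
  set β : ℝ := n / (2 ^ b * (1 - ε)) with hβ
  have hβ0 : 0 < β := by positivity
  have h1 : ∀ v ∈ range (2 ^ k), 1 / 2 ^ b * Real.exp (-(β * (v + 1 : ℕ))) ≤
      E (fun T : Tab c b A => ind (binVal (tabHash T q) = v) * ind (Miss T S (v + 1))) := by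
    intro v hv
    rw [Finset.mem_range] at hv
    have h2 := main_lower (b := b) hc q S.card v (lt_of_lt_of_le hv hkb) ε _ rfl (by
      rw [← hn, ← hL, hε, hp]
      gcongr
      have : v + 1 ≤ 2 ^ k := hv
      exact_mod_cast this) hε1 S hq le_rfl
    refine le_trans (le_of_eq ?_) h2
    congr 3
    rw [← hn, hβ]
    field_simp
  refine le_trans ?_ (Finset.sum_le_sum h1)
  rw [← Finset.mul_sum]
  have h2 := geo_lower β hβ0 (2 ^ k)
  have h3 : Real.exp (-(β * (2 ^ k : ℕ))) ≤ 1 / n := by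
    have h4 : Real.log n ≤ β * (2 ^ k : ℕ) := by
      refine hnp.trans ?_
      have : β * (2 ^ k : ℕ) = n * p / (1 - ε) := by
        rw [hβ, hp]; push_cast; field_simp
      rw [this, le_div_iff₀ h1ε]
      nlinarith [mul_pos hn0 hp0]
    calc _ ≤ Real.exp (-Real.log n) := Real.exp_le_exp.mpr (by linarith)
      _ = 1 / n := by rw [Real.exp_neg, Real.exp_log hn0, one_div]
  have h5 : (1 : ℝ) / 2 ^ b * (1 / β - 1 - 1 / β * (1 / n)) ≤
      1 / 2 ^ b * ∑ v ∈ range (2 ^ k), Real.exp (-(β * (v + 1 : ℕ))) := by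
    gcongr
    refine le_trans ?_ h2
    gcongr
  refine le_trans ?_ h5
  have h6 : (1 : ℝ) / 2 ^ b * (1 / β - 1 - 1 / β * (1 / n)) =
      1 / n - (ε / n + 1 / 2 ^ b + 1 / n ^ 2) + ε / n ^ 2 := by
    rw [hβ]; field_simp; ring
  rw [h6]
  have : 0 ≤ ε / n ^ 2 := by positivity
  linarith

lemma final_upper (hc : 1 ≤ c) (S : Finset (Fin c → A)) (q : Fin c → A) (hq : q ∉ S)
    (hS : 2 ≤ S.card) (k s : ℕ) (hk : k ≤ b) (L p : ℝ) (hp : p = 2 ^ k / 2 ^ b)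
    (hL : L = 2 * (S.card : ℝ) ^ (1 - 1 / (c : ℝ)))
    (hnp : k = b ∨ 2 * Real.log S.card ≤ S.card * p / 2 ^ s) :
    E (fun T : Tab c b A => ind (∀ x ∈ S, binVal (tabHash T q) < binVal (tabHash T x))) ≤
    1 / (S.card : ℝ) + (2 * L * p ^ 2 + (1 / (S.card : ℝ) ^ 2 + S.card * (L * p) ^ s)) := by
  have hn2 : (2 : ℝ) ≤ S.card := by exact_mod_cast hS
  set n : ℝ := (S.card : ℝ) with hn
  have hn0 : 0 < n := by linarith
  have hp0 : 0 < p := by rw [hp]; positivity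
  have hL0 : 0 ≤ L := by rw [hL]; positivity
  have hkb : (2 : ℕ) ^ k ≤ 2 ^ b := Nat.pow_le_pow_right (by norm_num) hk
  refine (pr_upper S q (2 ^ k)).trans ?_
  rw [← add_assoc]
  apply add_le_add
  · set β : ℝ := n / 2 ^ b with hβ
    have hβ0 : 0 < β := by positivity
    have h1 : ∀ v ∈ range (2 ^ k),
        E (fun T : Tab c b A => ind (binVal (tabHash T q) = v) * ind (Miss T S (v + 1))) ≤
        1 / 2 ^ b * Real.exp (-(β * (v + 1 : ℕ))) + 1 / 2 ^ b * (2 * p * L) := by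
      intro v hv
      rw [Finset.mem_range] at hv
      have h2 := main_upper (b := b) hc q S.card v (lt_of_lt_of_le hv hkb) L _ rfl hL S hq le_rfl
      refine h2.trans ?_
      rw [mul_add]
      apply add_le_add
      · apply le_of_eq
        congr 3
        rw [← hn, hβ]; ring
      · rw [hp]
        gcongr
        have : v + 1 ≤ 2 ^ k := hv
        exact_mod_cast this
    refine (Finset.sum_le_sum h1).trans ?_
    rw [Finset.sum_add_distrib, ← Finset.mul_sum, Finset.sum_const, Finset.card_range, nsmul_eq_mul]
    apply add_le_add
    · calc _ ≤ (1 : ℝ) / 2 ^ b * (1 / β) := by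
            gcongr
            exact geo_upper β hβ0 _
        _ = 1 / n := by rw [hβ]; field_simp
    · apply le_of_eq
      rw [hp]; push_cast; field_simp
  · rcases hnp with rfl | hnp
    · have : ∀ T : Tab c k A, ind (2 ^ k ≤ binVal (tabHash T q) ∧ Miss T S (2 ^ k)) = 0 :=
        fun T => ind_false fun h => absurd (binVal_lt (tabHash T q)) (not_lt.mpr h.1)
      simp only [this, E_const]
      positivity
    · refine le_trans (E_mono fun T => ind_mono fun h => h.2) ?_
      refine (tail_bound hc q S.card k s hk L p hp hL S hq le_rfl).trans ?_
      rw [← hn]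
      gcongr
      calc _ ≤ Real.exp (-(2 * Real.log n)) := Real.exp_le_exp.mpr (by
            have : p / 2 ^ s * n = n * p / 2 ^ s := by ring
            rw [this]; linarith)
        _ = 1 / n ^ 2 := by
            have : -(2 * Real.log n) = -Real.log n + -Real.log n := by ring
            rw [this, Real.exp_add, Real.exp_neg, Real.exp_log hn0]
            field_simp

end

end TabAux

set_option maxHeartbeats 4000000 in
open TabAux in
theorem TabAux.main_thm (c : ℕ) (hc : 1 ≤ c) :
    ∃ C : ℝ, 0 < C ∧
      ∀ (A : Type) [Fintype A] (S : Finset (Fin c → A)) (q : Fin c → A) (w : ℕ),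
        2 ≤ S.card → q ∉ S →
        (w : ℝ) ≥ (1 + 1 / (c : ℝ)) * Real.logb 2 (S.card : ℝ) →
        |tabPr c w A (fun T => ∀ x ∈ S, binVal (tabHash T q) < binVal (tabHash T x)) -
            1 / (S.card : ℝ)| ≤
          C * (Real.logb 2 (S.card : ℝ)) ^ 2 /
            (S.card : ℝ) ^ ((1 : ℝ) + 1 / (c : ℝ)) := by
  set s := 6 * c with hs
  set γ : ℝ := 2 * 2 ^ s with hγ
  have hγ2 : 2 ≤ γ := by
    have : (1 : ℝ) ≤ 2 ^ s := one_le_pow₀ (by norm_num)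
    linarith
  have hc1 : (1 : ℝ) ≤ c := by exact_mod_cast hc
  have hc0 : (0 : ℝ) < c := by linarith
  refine ⟨4 * γ + 3 + 16 * γ ^ 2 + (8 * γ * c) ^ s, by positivity, ?_⟩
  intro A _ S q w hS hq hw
  classical
  rw [tabPr_eq]
  have hn2 : (2 : ℝ) ≤ S.card := by exact_mod_cast hS
  set n : ℝ := (S.card : ℝ) with hn
  have hn0 : 0 < n := by linarith
  set l := Real.logb 2 n with hl
  set lam := Real.log n with hlam
  set ρ : ℝ := n ^ ((1 : ℝ) + 1 / (c : ℝ)) with hρ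
  have hρ0 : 0 < ρ := Real.rpow_pos_of_pos hn0 _
  have hl1 : 1 ≤ l := by
    rw [hl, Real.le_logb_iff_rpow_le (by norm_num) hn0]; simpa using hn2
  have hlog2 : 0 < Real.log 2 := Real.log_pos (by norm_num)
  have hlog2' : (1 / 2 : ℝ) ≤ Real.log 2 := by linarith [Real.log_two_gt_d9]
  have hlog2'' : Real.log 2 ≤ 1 := by linarith [Real.log_two_lt_d9]
  have hlaml : lam = l * Real.log 2 := by
    rw [hl, Real.logb, hlam]; field_simp
  have hlam_le : lam ≤ l := by rw [hlaml]; nlinarith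
  have hlam_ge : 1 / 2 ≤ lam := by rw [hlaml]; nlinarith
  have hρn2 : ρ ≤ n ^ 2 := by
    rw [hρ, ← Real.rpow_natCast]
    apply Real.rpow_le_rpow_of_exponent_le (by linarith)
    have : 1 / (c : ℝ) ≤ 1 := by rw [div_le_one hc0]; exact hc1
    push_cast; linarith
  have hnρ : n ≤ ρ := by
    rw [hρ]
    nth_rewrite 1 [← Real.rpow_one n]
    apply Real.rpow_le_rpow_of_exponent_le (by linarith)
    have : 0 ≤ 1 / (c : ℝ) := by positivity
    linarith
  have hm : ρ ≤ 2 ^ w := by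
    have h1 : ρ = (2 : ℝ) ^ ((1 + 1 / (c : ℝ)) * l) := by
      rw [mul_comm, Real.rpow_mul (by norm_num), hl, Real.rpow_logb (by norm_num) (by norm_num) hn0]
    rw [h1, ← Real.rpow_natCast]
    exact Real.rpow_le_rpow_of_exponent_le (by norm_num) hw
  obtain ⟨L, hL⟩ : ∃ L, L = 2 * n ^ (1 - 1 / (c : ℝ)) := ⟨_, rfl⟩
  have hL0 : 0 ≤ L := by rw [hL]; positivity
  have hLρ : L * ρ = 2 * n ^ 2 := by
    rw [hL, hρ, mul_assoc, ← Real.rpow_add hn0]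
    congr 1
    rw [← Real.rpow_natCast]; congr 1; push_cast; ring
  have hLeq : L = 2 * n ^ 2 / ρ := by rw [eq_div_iff hρ0.ne', hLρ]
  set t : ℝ := γ * lam / n with ht
  have ht0 : 0 < t := by positivity
  obtain ⟨k, hk, hp2, hkor⟩ := choose_k w t (by
    have h1 : t * n = γ * lam := by rw [ht]; field_simp
    have h2 : t * n ≤ t * 2 ^ w := by
      apply mul_le_mul_of_nonneg_left _ ht0.le
      linarith
    have h3 : 1 ≤ γ * lam := by nlinarith only [hγ2, hlam_ge]
    linarith)
  obtain ⟨p, hp⟩ : ∃ p : ℝ, p = 2 ^ k / 2 ^ w := ⟨_, rfl⟩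
  rw [← hp] at hp2 hkor
  have hp0 : 0 < p := by rw [hp]; positivity
  have hpn : p * n ≤ 2 * γ * lam := by
    have h1 : t * n = γ * lam := by rw [ht]; field_simp
    have h3 := mul_le_mul_of_nonneg_right hp2 hn0.le
    linarith
  have hnp1 : lam ≤ n * p := by
    rcases hkor with rfl | h
    · have : p = 1 := by rw [hp]; field_simp
      rw [this, mul_one, hlam]
      have := Real.log_le_sub_one_of_pos hn0
      linarith
    · have h1 : t * n = γ * lam := by rw [ht]; field_simp
      have h3 := mul_le_mul_of_nonneg_right h hn0.le
      have h4 : lam ≤ γ * lam := by nlinarith only [hγ2, hlam_ge]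
      linarith [mul_comm n p]
  have hnp2 : k = w ∨ 2 * lam ≤ n * p / 2 ^ s := by
    refine hkor.imp id fun h => ?_
    have h1 : t * n = γ * lam := by rw [ht]; field_simp
    rw [le_div_iff₀ (by positivity)]
    have : 2 * lam * 2 ^ s = γ * lam := by rw [hγ]; ring
    have h3 := mul_le_mul_of_nonneg_right h hn0.le
    rw [this]; linarith [mul_comm n p]
  have hlow := final_lower (b := w) hc S q hq hS k hk L p hp hL hnp1
  have hup := final_upper (b := w) hc S q hq hS k s hk L p hp hL hnp2
  rw [← hn] at hlow hup
  have hll : l ≤ l ^ 2 := by nlinarith only [hl1]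
  have hl2 : 1 ≤ l ^ 2 := by nlinarith only [hl1]
  have e0 : 1 / n ^ 2 ≤ 1 / ρ := one_div_le_one_div_of_le hρ0 hρn2
  have e1 : (1 : ℝ) / 2 ^ w ≤ 1 / ρ := one_div_le_one_div_of_le hρ0 hm
  have e2 : L * p / n ≤ 4 * γ * l ^ 2 / ρ := by
    rw [hLeq]
    have : 2 * n ^ 2 / ρ * p / n = 2 * (p * n) / ρ := by field_simp
    rw [this]
    apply div_le_div_of_nonneg_right _ hρ0.le
    have h5 : γ * lam ≤ γ * l ^ 2 := mul_le_mul_of_nonneg_left (hlam_le.trans hll) (by linarith)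
    linarith
  have e3 : 2 * L * p ^ 2 ≤ 16 * γ ^ 2 * l ^ 2 / ρ := by
    rw [hLeq]
    have : 2 * (2 * n ^ 2 / ρ) * p ^ 2 = 4 * (p * n) ^ 2 / ρ := by field_simp; ring
    rw [this]
    have h1 : p * n ≤ 2 * γ * l := hpn.trans (by gcongr)
    have h2 : 4 * (p * n) ^ 2 ≤ 4 * (2 * γ * l) ^ 2 := by gcongr
    have h3 : 4 * (2 * γ * l) ^ 2 = 16 * γ ^ 2 * l ^ 2 := by ring
    rw [h3] at h2
    gcongr
  have e4 : n * (L * p) ^ s ≤ (8 * γ * c) ^ s / ρ := by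
    set z : ℝ := n ^ (1 / (2 * (c : ℝ))) with hz
    have hz0 : 0 < z := Real.rpow_pos_of_pos hn0 _
    have hz2 : ρ = n * z ^ 2 := by
      rw [hz, hρ, ← Real.rpow_natCast, ← Real.rpow_mul hn0.le, Real.rpow_add hn0, Real.rpow_one]
      congr 2; push_cast; field_simp
    have hzs : z ^ s = n ^ 3 := by
      rw [hz, ← Real.rpow_natCast, ← Real.rpow_mul hn0.le, ← Real.rpow_natCast, hs]
      congr 1; push_cast; field_simp; norm_num
    have hlamz : lam ≤ 2 * c * z := by
      have := Real.log_le_rpow_div hn0.le (ε := 1 / (2 * (c : ℝ))) (by positivity)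
      rw [← hz, ← hlam] at this
      refine this.trans (le_of_eq ?_)
      field_simp
    have h1 : L * p ≤ 8 * γ * c / z := by
      rw [hLeq, hz2]
      have : 2 * n ^ 2 / (n * z ^ 2) * p = 2 * (p * n) / z ^ 2 := by field_simp
      rw [this, div_le_div_iff₀ (by positivity) hz0]
      have h2 : p * n ≤ 2 * γ * (2 * c * z) := hpn.trans (by gcongr)
      calc 2 * (p * n) * z ≤ 2 * (2 * γ * (2 * c * z)) * z := by gcongr
        _ = _ := by ring
    calc n * (L * p) ^ s ≤ n * (8 * γ * c / z) ^ s := by gcongr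
      _ = (8 * γ * c) ^ s / n ^ 2 := by rw [div_pow, hzs]; field_simp
      _ ≤ _ := by gcongr
  have e5 : (4 * γ + 3 + 16 * γ ^ 2 + (8 * γ * c) ^ s) * l ^ 2 / ρ =
      4 * γ * l ^ 2 / ρ + 3 * (l ^ 2 / ρ) + 16 * γ ^ 2 * l ^ 2 / ρ +
      (8 * γ * c) ^ s * (l ^ 2 / ρ) := by ring
  have e6 : 1 / ρ ≤ l ^ 2 / ρ := by gcongr
  have e7 : (8 * γ * c) ^ s / ρ ≤ (8 * γ * c) ^ s * (l ^ 2 / ρ) := by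
    rw [div_eq_mul_one_div]; gcongr
  have p1 : 0 ≤ 4 * γ * l ^ 2 / ρ := by positivity
  have p2 : 0 ≤ l ^ 2 / ρ := by positivity
  have p3 : 0 ≤ 16 * γ ^ 2 * l ^ 2 / ρ := by positivity
  have p4 : 0 ≤ (8 * γ * c) ^ s * (l ^ 2 / ρ) := by positivity
  rw [e5, abs_le]
  constructor
  · linarith
  · linarith


/-- Simple tabulation is `ε`-minwise independent with `ε = O(log² n / n^{1/c})`:
the probability that the query key hashes strictly below all keys of `S` is
`(1 ± ε)/n`. -/
theorem simple_tabulation_minwise :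
    ∀ c : ℕ, 1 ≤ c →
    ∃ C : ℝ, 0 < C ∧
      ∀ (A : Type) [Fintype A] (S : Finset (Fin c → A)) (q : Fin c → A) (w : ℕ),
        2 ≤ S.card → q ∉ S →
        (w : ℝ) ≥ (1 + 1 / (c : ℝ)) * Real.logb 2 (S.card : ℝ) →
        |tabPr c w A (fun T => ∀ x ∈ S, binVal (tabHash T q) < binVal (tabHash T x)) -
            1 / (S.card : ℝ)| ≤
          C * (Real.logb 2 (S.card : ℝ)) ^ 2 /
            (S.card : ℝ) ^ ((1 : ℝ) + 1 / (c : ℝ)) := by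
  intro c hc
  exact TabAux.main_thm c hc
end

section
/- Let x₁, …, x₅ ∈ Σ^c be any 5 distinct keys and let h be a random simple tabulation hash function into (ZMod 2)^b. Then there exists an index j ∈ {1, …, 5} such that the random variable h(x_j) is independent of the random 4-tuple (h(x_k))_{k ≠ j}, and h(x_j) is uniformly distributed on (ZMod 2)^b. -/
open Finset MeasureTheory ProbabilityTheory

/-- Discrete measurable structure on `ZMod n`. -/
instance (n : ℕ) : MeasurableSpace (ZMod n) := ⊤

section
open Classical

lemma aux_count {Ω G H : Type*} [Fintype Ω] [Fintype G] [AddCommGroup G]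
    (f : Ω → G) (g : Ω → H) (S : G → Ω ≃ Ω) (hf : ∀ v ω, f (S v ω) = f ω + v)
    (hg : ∀ v ω, g (S v ω) = g ω) (U : Set G) (B : Set H) :
    Fintype.card G * (univ.filter fun ω => f ω ∈ U ∧ g ω ∈ B).card =
      (univ.filter fun a => a ∈ U).card * (univ.filter fun ω => g ω ∈ B).card := by
  have h1 : ∀ v : G, (∑ ω, if f ω + v ∈ U ∧ g ω ∈ B then 1 else 0) =
      (univ.filter fun ω => f ω ∈ U ∧ g ω ∈ B).card := by
    intro v
    rw [Finset.card_filter]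
    refine Fintype.sum_equiv (S v) _ _ fun ω => ?_
    simp only [hf, hg]
  have h2 : ∀ ω, (∑ v, if f ω + v ∈ U ∧ g ω ∈ B then 1 else 0) =
      (univ.filter fun a => a ∈ U).card * (if g ω ∈ B then 1 else 0) := by
    intro ω
    by_cases h : g ω ∈ B
    · simp only [h, and_true, if_true, mul_one]
      rw [Finset.card_filter]
      exact Fintype.sum_equiv (Equiv.addLeft (f ω)) _ _ fun v => rfl
    · simp [h]
  calc _ = ∑ v : G, ∑ ω, (if f ω + v ∈ U ∧ g ω ∈ B then 1 else 0) := by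
        simp only [h1]; simp
    _ = _ := by
        rw [Finset.sum_comm]; simp only [h2]
        rw [← Finset.mul_sum, ← Finset.card_filter]

lemma aux_prob {Ω G H : Type*} [Fintype Ω] [Nonempty Ω] [Fintype G] [AddCommGroup G]
    [MeasurableSpace Ω] [DiscreteMeasurableSpace Ω] [MeasurableSpace G]
    [DiscreteMeasurableSpace G] [MeasurableSpace H]
    (f : Ω → G) (g : Ω → H) (S : G → Ω ≃ Ω) (hf : ∀ v ω, f (S v ω) = f ω + v)
    (hg : ∀ v ω, g (S v ω) = g ω) :
    IndepFun f g (PMF.uniformOfFintype Ω).toMeasure ∧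
      Measure.map f (PMF.uniformOfFintype Ω).toMeasure =
        (PMF.uniformOfFintype G).toMeasure := by
  have key : ∀ s : Set Ω, (PMF.uniformOfFintype Ω).toMeasure s =
      ((univ.filter fun ω => ω ∈ s).card : ENNReal) / (Fintype.card Ω : ENNReal) := by
    intro s
    rw [PMF.toMeasure_uniformOfFintype_apply s (MeasurableSet.of_discrete), Fintype.card_subtype]
  have hO : (Fintype.card Ω : ENNReal) ≠ 0 := by simp
  have hG : (Fintype.card G : ENNReal) ≠ 0 := by simp
  have hU : ∀ U : Set G, Fintype.card G * (univ.filter fun ω => f ω ∈ U).card =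
      (univ.filter fun a => a ∈ U).card * Fintype.card Ω := by
    intro U
    simpa using aux_count f g S hf hg U Set.univ
  constructor
  · rw [indepFun_iff_measure_inter_preimage_eq_mul]
    intro U B _ _
    rw [key, key, key]
    have h1 := aux_count f g S hf hg U B
    have h2 := hU U
    have h3 : (univ.filter fun ω => f ω ∈ U ∧ g ω ∈ B).card * Fintype.card Ω =
        (univ.filter fun ω => f ω ∈ U).card * (univ.filter fun ω => g ω ∈ B).card := by
      apply Nat.eq_of_mul_eq_mul_left (Fintype.card_pos : 0 < Fintype.card G)
      rw [← mul_assoc, h1, ← mul_assoc, h2]; ring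
    have h4 : ((univ.filter fun ω => f ω ∈ U ∧ g ω ∈ B).card : ENNReal) * Fintype.card Ω =
        (univ.filter fun ω => f ω ∈ U).card * (univ.filter fun ω => g ω ∈ B).card := by
      exact_mod_cast h3
    simp only [Set.mem_inter_iff, Set.mem_preimage]
    rw [div_eq_mul_inv, div_eq_mul_inv, div_eq_mul_inv, mul_mul_mul_comm, ← h4, mul_assoc,
      ← mul_assoc (Fintype.card Ω : ENNReal), ENNReal.mul_inv_cancel hO (by simp), one_mul]
  · ext U hUm
    rw [Measure.map_apply (measurable_of_finite f) hUm, key,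
      PMF.toMeasure_uniformOfFintype_apply U hUm, Fintype.card_subtype]
    have h4 : (Fintype.card G : ENNReal) * (univ.filter fun ω => f ω ∈ U).card =
      (univ.filter fun a => a ∈ U).card * Fintype.card Ω := by exact_mod_cast hU U
    simp only [Set.mem_preimage]
    rw [ENNReal.div_eq_div_iff hG (by simp) hO (by simp), h4, mul_comm]

end

lemma aux_dec2 : ∀ g : Fin 5 → ZMod 2, ∑ k, g k = 0 →
    (∃ k, g k = 1) → (∀ k l, k ≠ l → g ≠ Pi.single k 1 + Pi.single l 1) →
    ∃ m, ∀ k, g k = if k = m then 0 else 1 := by decide +kernel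

lemma aux_dec3 : ∀ m n : Fin 5, m ≠ n → (fun k => if k = m then (0 : ZMod 2) else 1) +
    (fun k => if k = n then (0 : ZMod 2) else 1) = Pi.single m 1 + Pi.single n 1 := by
  decide +kernel

/-- Indicator vector of a key. -/
def keyVec {c : ℕ} {A : Type} [DecidableEq A] (x : Fin c → A) : Fin c × A → ZMod 2 :=
  fun p => if x p.1 = p.2 then 1 else 0

lemma aux_dep {c : ℕ} {A : Type} [Fintype A] [DecidableEq A]
    (x : Fin 5 → (Fin c → A)) (hx : Function.Injective x) :
    ∃ j, keyVec (x j) ∉ Submodule.span (ZMod 2) ((fun k => keyVec (x k)) '' {k | k ≠ j}) := by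
  by_contra! hcon
  have hc : 0 < c := by
    rcases Nat.eq_zero_or_pos c with h | h
    · subst h
      exact absurd (hx (Subsingleton.elim (x 0) (x 1))) (by decide)
    · exact h
  have hsum : ∀ g : Fin 5 → ZMod 2, ∑ k, g k • keyVec (x k) = 0 → ∑ k, g k = 0 := by
    intro g hg
    have h1 : ∑ a, (∑ k, g k • keyVec (x k)) (⟨0, hc⟩, a) = 0 := by rw [hg]; simp
    simp only [Finset.sum_apply, Pi.smul_apply, smul_eq_mul, keyVec] at h1
    rw [Finset.sum_comm] at h1
    simpa using h1
  have hpair : ∀ k l, k ≠ l → ∑ t, (Pi.single k 1 + Pi.single l 1 : Fin 5 → ZMod 2) t •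
      keyVec (x t) ≠ 0 := by
    intro k l hkl h
    apply hkl
    apply hx
    funext i
    simp only [Pi.add_apply, add_smul, Finset.sum_add_distrib, Pi.single_apply, ite_smul,
      one_smul, zero_smul, Finset.sum_ite_eq', Finset.mem_univ, if_true] at h
    have h2 := congrFun h (i, x k i)
    by_contra hne
    simp [keyVec, Ne.symm hne] at h2
  have hex : ∀ j, ∃ g : Fin 5 → ZMod 2, ∑ k, g k • keyVec (x k) = 0 ∧ g j = 1 := by
    intro j
    obtain ⟨g, hg1, hg2⟩ := (Finsupp.mem_span_image_iff_linearCombination (ZMod 2)).1 (hcon j)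
    rw [Finsupp.linearCombination_apply, Finsupp.sum_fintype _ _ (by simp)] at hg2
    have hgj : g j = 0 := by
      by_contra h
      have := (Finsupp.mem_supported _ _).1 hg1 (Finsupp.mem_support_iff.2 h)
      exact this rfl
    refine ⟨fun k => g k + (Pi.single j 1 : Fin 5 → ZMod 2) k, ?_, by simp [hgj]⟩
    simp only [add_smul, Finset.sum_add_distrib, Pi.single_apply, ite_smul,
      one_smul, zero_smul, Finset.sum_ite_eq', Finset.mem_univ, if_true]
    rw [hg2]
    funext p
    exact CharTwo.add_self_eq_zero _
  have hmiss : ∀ j, ∃ m, m ≠ j ∧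
      ∑ k, (fun k => if k = m then (0 : ZMod 2) else 1) k • keyVec (x k) = 0 := by
    intro j
    obtain ⟨g, h0, h1⟩ := hex j
    obtain ⟨m, hm⟩ := aux_dec2 g (hsum g h0) ⟨j, h1⟩ (by
      rintro k l hkl rfl
      exact hpair k l hkl h0)
    refine ⟨m, ?_, ?_⟩
    · rintro rfl
      simp [hm] at h1
    · simpa only [hm] using h0
  obtain ⟨m, -, hm⟩ := hmiss 0
  obtain ⟨n, hmn, hn⟩ := hmiss m
  apply hpair m n hmn.symm
  rw [← aux_dec3 m n hmn.symm]
  simp only [Pi.add_apply, add_smul, Finset.sum_add_distrib]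
  rw [hm, hn, add_zero]

lemma aux_dual {c : ℕ} {A : Type} [Fintype A] [DecidableEq A]
    (x : Fin 5 → (Fin c → A)) (hx : Function.Injective x) :
    ∃ j, ∃ S : Fin c → A → ZMod 2, ∑ i, S i (x j i) = 1 ∧
      ∀ k, k ≠ j → ∑ i, S i (x k i) = 0 := by
  obtain ⟨j, hj⟩ := aux_dep x hx
  obtain ⟨f, hf1, hf2⟩ := Submodule.exists_le_ker_of_notMem hj
  have hS : ∀ y : Fin c → A, ∑ i, f (Pi.single (i, y i) 1) = f (keyVec y) := by
    intro y
    rw [← map_sum]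
    congr 1
    funext p
    obtain ⟨i, a⟩ := p
    simp only [Finset.sum_apply, Pi.single_apply, Prod.mk.injEq, keyVec]
    rw [Finset.sum_eq_single i]
    · simp [eq_comm]
    · intro t _ ht
      simp [Ne.symm ht]
    · simp
  refine ⟨j, fun i a => f (Pi.single (i, a) 1), ?_, ?_⟩
  · rw [hS]
    generalize f (keyVec (x j)) = z at hf1
    revert z; decide
  · intro k hk
    rw [hS]
    exact hf2 (Submodule.subset_span ⟨k, hk, rfl⟩)

/-- Among any 5 distinct keys, under a uniformly random simple tabulation hash
function, some key's hash code is independent of the 4-tuple of the other keys'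
hash codes, and is itself uniformly distributed. -/
theorem five_keys_one_hash_independent
    (c b : ℕ) (A : Type) [Fintype A] [DecidableEq A]
    (x : Fin 5 → (Fin c → A)) (hx : Function.Injective x) :
    ∃ j : Fin 5,
      IndepFun (fun Tb : Fin c → A → (Fin b → ZMod 2) => tabHash Tb (x j))
          (fun (Tb : Fin c → A → (Fin b → ZMod 2)) (k : {k : Fin 5 // k ≠ j}) =>
            tabHash Tb (x k))
          ((PMF.uniformOfFintype (Fin c → A → (Fin b → ZMod 2))).toMeasure) ∧
        Measure.map (fun Tb : Fin c → A → (Fin b → ZMod 2) => tabHash Tb (x j))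
            ((PMF.uniformOfFintype (Fin c → A → (Fin b → ZMod 2))).toMeasure) =
          (PMF.uniformOfFintype (Fin b → ZMod 2)).toMeasure := by
  obtain ⟨j, S, h1, h0⟩ := aux_dual x hx
  have hadd : ∀ (v : Fin b → ZMod 2) (Tb : Fin c → A → (Fin b → ZMod 2)) (y : Fin c → A),
      tabHash (Tb + fun i a => S i a • v) y = tabHash Tb y + (∑ i, S i (y i)) • v := by
    intro v Tb y
    simp only [tabHash, Pi.add_apply, Finset.sum_add_distrib, Finset.sum_smul]
  have : DiscreteMeasurableSpace (ZMod 2) := ⟨fun _ => trivial⟩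
  refine ⟨j, aux_prob _ _ (fun v => Equiv.addRight (fun i a => S i a • v)) ?_ ?_⟩
  · intro v Tb
    simp only [Equiv.coe_addRight]
    rw [hadd, h1, one_smul]
  · intro v Tb
    funext k
    simp only [Equiv.coe_addRight]
    rw [hadd, h0 k k.2, zero_smul, add_zero]
end

section
/- Let c ≥ 1, let ε > 0 and γ > 0 be constants, let Σ be a finite alphabet, let m = 2^b, and let S ⊆ Σ^c be a set of n keys with n ≤ m^{1−ε}. Let d = min{ ((1+γ)/ε)^c , 2^{(1+γ)/ε} }. Then under a random simple tabulation hash function h into m bins, with probability at least 1 − m^{−γ}, every bin receives fewer than d keys of S, i.e., for every B ∈ (ZMod 2)^b, |{x ∈ S : h(x) = B}| < d. -/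
open Finset

open Classical in
noncomputable def tabVec {c : ℕ} {A : Type} (x : Fin c → A) : Fin c → A → ZMod 2 :=
  fun i => Pi.single (x i) 1

open Classical in
lemma tabHash_surj {c b t : ℕ} {A : Type} (f : Fin t → Fin c → A)
    (hf : LinearIndependent (ZMod 2) (fun k => tabVec (f k)))
    (g : Fin t → (Fin b → ZMod 2)) :
    ∃ T : Fin c → A → (Fin b → ZMod 2), ∀ k, tabHash T (f k) = g k := by
  let B := Module.Basis.span hf
  obtain ⟨L, hL⟩ := LinearMap.exists_extend (B.constr (ZMod 2) g)
  refine ⟨fun i a => L (Pi.single i (Pi.single a 1)), fun k => ?_⟩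
  have h1 : L (tabVec (f k)) = g k := by
    have h2 : B.constr (ZMod 2) g (B k) = g k := B.constr_basis (ZMod 2) g k
    rw [← hL] at h2
    simpa [B, Module.Basis.span_apply] using h2
  rw [← h1, tabHash]
  rw [← map_sum]
  congr 1
  exact Finset.univ_sum_single (tabVec (f k))

open Classical in
lemma tabHash_count {c b t : ℕ} {A : Type} [Fintype A] (f : Fin t → Fin c → A)
    (hf : LinearIndependent (ZMod 2) (fun k => tabVec (f k)))
    (g : Fin t → (Fin b → ZMod 2)) :
    (univ.filter (fun T : Fin c → A → (Fin b → ZMod 2) => ∀ k, tabHash T (f k) = g k)).card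
      * (2 ^ b) ^ t = Fintype.card (Fin c → A → (Fin b → ZMod 2)) := by
  let φ : (Fin c → A → (Fin b → ZMod 2)) →+ (Fin t → (Fin b → ZMod 2)) :=
    { toFun := fun T k => tabHash T (f k)
      map_zero' := by ext; simp [tabHash]
      map_add' := by intro T T'; ext; simp [tabHash, Finset.sum_add_distrib] }
  have hs : Function.Surjective φ := by
    intro g
    obtain ⟨T, hT⟩ := tabHash_surj f hf g
    exact ⟨T, funext hT⟩
  have key : ∀ y, (univ.filter (fun T => φ T = y)).card = (univ.filter (fun T => φ T = g)).card :=
    fun y => AddMonoidHom.card_fiber_eq_of_mem_range φ (hs y) (hs g)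
  have h := Finset.card_eq_sum_card_fiberwise (f := φ) (s := univ) (t := univ) (by simp)
  simp only [key] at h
  rw [Finset.sum_const] at h
  simp only [Finset.card_univ, Fintype.card_pi, ZMod.card, Finset.prod_const, Fintype.card_fin,
    smul_eq_mul] at h
  have e : (univ.filter (fun T => φ T = g)) = univ.filter
      (fun T : Fin c → A → (Fin b → ZMod 2) => ∀ k, tabHash T (f k) = g k) := by
    ext T
    simp [φ, funext_iff]
  rw [e] at h
  simp only [Fintype.card_pi, ZMod.card, Finset.prod_const, Fintype.card_fin, Finset.card_univ]
  rw [h, mul_comm]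

lemma tabVec_injective {c : ℕ} {A : Type} :
    Function.Injective (tabVec : (Fin c → A) → Fin c → A → ZMod 2) := by
  classical
  intro x y h
  funext i
  have h1 := congrFun (congrFun h i) (x i)
  by_contra hne
  simp [tabVec, Pi.single_apply, hne] at h1

lemma exists_indep_root {c t : ℕ} (hc : 1 ≤ c) {A : Type} (X : Finset (Fin c → A))
    (h : t ^ c < X.card) :
    ∃ f : Fin (t + 1) → Fin c → A, (∀ k, f k ∈ X) ∧
      LinearIndependent (ZMod 2) (fun k => tabVec (f k)) := by
  classical
  have h1 : ∃ i, t < (X.image (fun x => x i)).card := by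
    by_contra! hcon
    have hsub : X ⊆ Fintype.piFinset (fun i => X.image (fun x => x i)) := by
      intro x hx
      rw [Fintype.mem_piFinset]
      exact fun i => Finset.mem_image_of_mem (fun x => x i) hx
    have := Finset.card_le_card hsub
    rw [Fintype.card_piFinset] at this
    have h2 : ∏ i : Fin c, (X.image (fun x => x i)).card ≤ ∏ i : Fin c, t :=
      Finset.prod_le_prod' (fun i _ => hcon i)
    simp at h2
    omega
  obtain ⟨i, hi⟩ := h1
  obtain ⟨Y, hY, hYc⟩ := Finset.exists_subset_card_eq (Nat.succ_le_of_lt hi)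
  let e : Fin (t + 1) ≃ Y := (Finset.equivFinOfCardEq hYc).symm
  have h3 : ∀ k, ∃ x ∈ X, x i = (e k : A) := fun k => by
    have := hY (e k).2
    simpa using this
  choose f hfX hf using h3
  refine ⟨f, hfX, ?_⟩
  apply LinearIndependent.of_comp (LinearMap.proj i : (Fin c → A → ZMod 2) →ₗ[ZMod 2] _)
  have h4 : (⇑(LinearMap.proj i : (Fin c → A → ZMod 2) →ₗ[ZMod 2] (A → ZMod 2)) ∘
      fun k => tabVec (f k)) = (fun a : A => (Pi.single a 1 : A → ZMod 2)) ∘ (fun k => (e k : A)) := by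
    funext k
    simp [tabVec, hf]
  rw [h4]
  exact (Pi.linearIndependent_single_one A (ZMod 2)).comp _
    (Subtype.val_injective.comp e.injective)

lemma exists_indep_log {c t : ℕ} {A : Type} [Fintype A] (X : Finset (Fin c → A))
    (h : 2 ^ t < X.card) :
    ∃ f : Fin (t + 1) → Fin c → A, (∀ k, f k ∈ X) ∧
      LinearIndependent (ZMod 2) (fun k => tabVec (f k)) := by
  classical
  obtain ⟨s, hs, hspan, hli⟩ := exists_linearIndependent (ZMod 2)
    ((X.image tabVec : Finset (Fin c → A → ZMod 2)) : Set (Fin c → A → ZMod 2))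
  have hfin : s.Finite := (Finset.finite_toSet _).subset hs
  lift s to Finset (Fin c → A → ZMod 2) using hfin
  have hr : Module.finrank (ZMod 2) (Submodule.span (ZMod 2) (s : Set (Fin c → A → ZMod 2))) = s.card :=
    finrank_span_finset_eq_card hli
  have hcard : Nat.card (Submodule.span (ZMod 2) (s : Set (Fin c → A → ZMod 2))) = 2 ^ s.card := by
    rw [Module.natCard_eq_pow_finrank (K := ZMod 2), hr]; simp
  have hle : X.card ≤ Nat.card (Submodule.span (ZMod 2) (s : Set (Fin c → A → ZMod 2))) := by
    rw [← Finset.card_image_of_injective X tabVec_injective, hspan]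
    have := Nat.card_mono (Set.toFinite _) (Submodule.subset_span (R := ZMod 2)
      (s := ((X.image tabVec : Finset (Fin c → A → ZMod 2)) : Set (Fin c → A → ZMod 2))))
    simpa using this
  have hlt : t < s.card := by
    rw [hcard] at hle
    exact (Nat.pow_lt_pow_iff_right (by norm_num)).1 (h.trans_le hle)
  obtain ⟨Y, hY, hYc⟩ := Finset.exists_subset_card_eq (Nat.succ_le_of_lt hlt)
  let e : Fin (t + 1) ≃ Y := (Finset.equivFinOfCardEq hYc).symm
  have h3 : ∀ k, ∃ x ∈ X, tabVec x = (e k : Fin c → A → ZMod 2) := fun k => by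
    have := hs (hY (e k).2)
    simpa using this
  choose f hfX hf using h3
  refine ⟨f, hfX, ?_⟩
  simp only [hf]
  exact hli.comp (fun k => (⟨e k, hY (e k).2⟩ : (s : Set (Fin c → A → ZMod 2)))) (by
    intro k l hkl
    apply e.injective
    apply Subtype.ext
    simpa using hkl)

open Classical in
lemma bad_count {c b t : ℕ} {A : Type} [Fintype A] (S : Finset (Fin c → A))
    (Q : (Fin c → A → (Fin b → ZMod 2)) → Prop)
    (hQ : ∀ T, Q T → ∃ B : Fin b → ZMod 2, ∃ f : Fin t → Fin c → A,
      (∀ k, f k ∈ S ∧ tabHash T (f k) = B) ∧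
      LinearIndependent (ZMod 2) (fun k => tabVec (f k))) :
    (univ.filter Q).card * (2 ^ b) ^ t ≤
      S.card ^ t * 2 ^ b * Fintype.card (Fin c → A → (Fin b → ZMod 2)) := by
  let F := (Fintype.piFinset (fun _ : Fin t => S)).filter
    (fun f => LinearIndependent (ZMod 2) (fun k => tabVec (f k)))
  let E : (Fin t → Fin c → A) × (Fin b → ZMod 2) → Finset (Fin c → A → (Fin b → ZMod 2)) :=
    fun p => univ.filter (fun T => ∀ k, tabHash T (p.1 k) = p.2)
  have hsub : univ.filter Q ⊆ (F ×ˢ univ).biUnion E := by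
    intro T hT
    obtain ⟨B, f, h1, h2⟩ := hQ T (by simpa using hT)
    rw [Finset.mem_biUnion]
    refine ⟨(f, B), ?_, ?_⟩
    · simp [F, h2]
      exact fun k => (h1 k).1
    · simp [E]
      exact fun k => (h1 k).2
  have hF : F.card ≤ S.card ^ t := by
    refine (Finset.card_filter_le _ _).trans ?_
    simp
  calc (univ.filter Q).card * (2 ^ b) ^ t
      ≤ (∑ p ∈ F ×ˢ univ, (E p).card) * (2 ^ b) ^ t :=
        Nat.mul_le_mul_right _ ((Finset.card_le_card hsub).trans Finset.card_biUnion_le)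
    _ = ∑ p ∈ F ×ˢ (univ : Finset (Fin b → ZMod 2)),
          Fintype.card (Fin c → A → (Fin b → ZMod 2)) := by
        rw [Finset.sum_mul]
        refine Finset.sum_congr rfl fun p hp => ?_
        have hp1 : LinearIndependent (ZMod 2) (fun k => tabVec (p.1 k)) := by
          have := (Finset.mem_product.1 hp).1
          exact (Finset.mem_filter.1 this).2
        exact tabHash_count p.1 hp1 (fun _ => p.2)
    _ = F.card * 2 ^ b * Fintype.card (Fin c → A → (Fin b → ZMod 2)) := by
        rw [Finset.sum_const, Finset.card_product, smul_eq_mul]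
        congr 2
        simp [ZMod.card]
    _ ≤ _ := by gcongr

/-- Hashing `n ≤ m^{1-ε}` keys into `m` bins by simple tabulation, with probability
at least `1 - m^{-γ}` every bin gets fewer than
`min(((1+γ)/ε)^c, 2^{(1+γ)/ε})` keys (Lemma 1 of the paper). -/
theorem simple_tabulation_many_bins
    (c : ℕ) (hc : 1 ≤ c) (ε γ : ℝ) (hε : 0 < ε) (hγ : 0 < γ)
    (A : Type) [Fintype A] (b : ℕ) (S : Finset (Fin c → A))
    (hn : (S.card : ℝ) ≤ ((2 : ℝ) ^ b) ^ ((1 : ℝ) - ε)) :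
    tabPr c b A (fun T =>
        ∀ B : Fin b → ZMod 2,
          ((S.filter (fun x => tabHash T x = B)).card : ℝ) <
            min (((1 + γ) / ε) ^ c) ((2 : ℝ) ^ ((1 + γ) / ε))) ≥
      1 - ((2 : ℝ) ^ b) ^ (-γ) := by
  classical
  set r := (1 + γ) / ε with hr
  have hr0 : 0 < r := by positivity
  set P : (Fin c → A → (Fin b → ZMod 2)) → Prop := fun T => ∀ B : Fin b → ZMod 2,
          ((S.filter (fun x => tabHash T x = B)).card : ℝ) < min (r ^ c) ((2 : ℝ) ^ r) with hP
  obtain ⟨t, ht⟩ : ∃ t, ⌈r⌉₊ = t + 1 :=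
    ⟨⌈r⌉₊ - 1, by have := Nat.ceil_pos.2 hr0; omega⟩
  have ht1 : r ≤ (t + 1 : ℕ) := ht ▸ Nat.le_ceil r
  have ht2 : (t : ℝ) < r := Nat.lt_ceil.1 (by omega)
  have hbad := bad_count (t := t + 1) S (fun T => ¬ P T) (by
    intro T hT
    simp only [hP, not_forall, not_lt, min_le_iff] at hT
    obtain ⟨B, hB⟩ := hT
    refine ⟨B, ?_⟩
    have hX : ∃ f : Fin (t + 1) → Fin c → A, (∀ k, f k ∈ S.filter (fun x => tabHash T x = B)) ∧
        LinearIndependent (ZMod 2) (fun k => tabVec (f k)) := by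
      rcases hB with hB | hB
      · apply exists_indep_root hc
        have : (t : ℝ) ^ c < r ^ c := pow_lt_pow_left₀ ht2 (by positivity) (by omega)
        exact_mod_cast (this.trans_le hB)
      · apply exists_indep_log
        have : (2 : ℝ) ^ t < 2 ^ r := by
          rw [← Real.rpow_natCast]
          exact Real.rpow_lt_rpow_of_exponent_lt (by norm_num) ht2
        exact_mod_cast (this.trans_le hB)
    obtain ⟨f, h1, h2⟩ := hX
    exact ⟨f, fun k => by simpa using h1 k, h2⟩)
  have hbad2 : (univ.filter (fun T => ¬ P T)).card * (2 ^ b) ^ (t + 1) ≤ S.card ^ (t + 1) * 2 ^ b *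
      Fintype.card (Fin c → A → (Fin b → ZMod 2)) := by convert hbad
  clear hbad
  have hsum : (univ.filter P).card + (univ.filter (fun T => ¬ P T)).card =
      Fintype.card (Fin c → A → (Fin b → ZMod 2)) := by
    rw [Finset.card_filter_add_card_filter_not, Finset.card_univ]
  have hN : 0 < Fintype.card (Fin c → A → (Fin b → ZMod 2)) := Fintype.card_pos
  rw [tabPr, Nat.card_eq_fintype_card, Nat.card_eq_fintype_card, Fintype.card_subtype]
  generalize (univ.filter P).card = p at *
  generalize (univ.filter (fun T => ¬ P T)).card = q at *
  generalize Fintype.card (Fin c → A → (Fin b → ZMod 2)) = N at *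
  set m : ℝ := (2 : ℝ) ^ b with hm
  have hm1 : 1 ≤ m := one_le_pow₀ (by norm_num)
  have hm0 : 0 < m := by positivity
  have hbad' : (q : ℝ) * m ^ (t + 1) ≤ (S.card : ℝ) ^ (t + 1) * m * N := by
    rw [hm]; exact_mod_cast hbad2
  have hpow : (S.card : ℝ) ^ (t + 1) * m ≤ m ^ (-γ) * m ^ (t + 1) := by
    calc (S.card : ℝ) ^ (t + 1) * m ≤ (m ^ (1 - ε)) ^ (t + 1) * m := by gcongr
      _ = m ^ ((1 - ε) * (t + 1 : ℕ) + 1) := by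
        rw [Real.rpow_add hm0, Real.rpow_mul hm0.le, Real.rpow_natCast, Real.rpow_one]
      _ ≤ m ^ (-γ + (t + 1 : ℕ)) := by
        apply Real.rpow_le_rpow_of_exponent_le hm1
        rw [hr, div_le_iff₀ hε] at ht1
        nlinarith
      _ = _ := by rw [Real.rpow_add hm0, Real.rpow_natCast]
  have hq : (q : ℝ) ≤ m ^ (-γ) * N := by
    have hmt : 0 < m ^ (t + 1) := by positivity
    have : (q : ℝ) * m ^ (t + 1) ≤ (m ^ (-γ) * N) * m ^ (t + 1) := by
      calc _ ≤ _ := hbad'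
        _ ≤ (m ^ (-γ) * m ^ (t + 1)) * N := by gcongr
        _ = _ := by ring
    exact le_of_mul_le_mul_right this hmt
  have hN' : (0 : ℝ) < N := by exact_mod_cast hN
  have hs' : (p : ℝ) + q = N := by exact_mod_cast hsum
  rw [ge_iff_le, le_div_iff₀ hN']
  linarith
end

section
/- Let c ≥ 1 and let T ⊆ Σ^c be a nonempty finite set of keys with |T| = d. Then T contains a peelable subset of some size t satisfying both t ≥ d^{1/c} and t ≥ log₂ d. -/
open Finset

/-- A set of keys is peelable if its keys can be ordered so that each key contains a
position-character not appearing in any earlier key. -/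
def Peelable {c : ℕ} {A : Type} (T : Finset (Fin c → A)) : Prop :=
  ∃ (t : ℕ) (e : Fin t ≃ {x // x ∈ T}),
    ∀ j : Fin t, ∃ i : Fin c, ∀ k : Fin t, k < j →
      (e j : Fin c → A) i ≠ (e k : Fin c → A) i

theorem peelable_empty {c : ℕ} {A : Type} : Peelable (∅ : Finset (Fin c → A)) := by
  refine ⟨0, Equiv.equivOfIsEmpty _ _, fun j => j.elim0⟩

theorem peelable_insert {c : ℕ} {A : Type} [DecidableEq A] (P : Finset (Fin c → A))
    (hP : Peelable P) (x : Fin c → A) (i : Fin c) (hx : ∀ y ∈ P, x i ≠ y i) :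
    Peelable (insert x P) := by
  obtain ⟨t, e, he⟩ := hP
  have hxP : x ∉ P := fun h => hx x h rfl
  let f : Fin (t + 1) → {y // y ∈ insert x P} :=
    Fin.lastCases (motive := fun _ => {y // y ∈ insert x P}) ⟨x, Finset.mem_insert_self _ _⟩
      (fun j => ⟨(e j).1, Finset.mem_insert_of_mem (e j).2⟩)
  have f1 : (f (Fin.last t)).1 = x := by simp [f]
  have f2 : ∀ j : Fin t, (f j.castSucc).1 = (e j).1 := by intro j; simp [f]
  have hf : Function.Bijective f := by
    rw [Function.Bijective]
    constructor
    · intro a b hab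
      have hab : (f a).1 = (f b).1 := by rw [hab]
      induction a using Fin.lastCases with
      | last =>
        induction b using Fin.lastCases with
        | last => rfl
        | cast b =>
          rw [f1, f2] at hab
          exact absurd (hab ▸ (e b).2) hxP
      | cast a =>
        induction b using Fin.lastCases with
        | last =>
          rw [f1, f2] at hab
          exact absurd (hab ▸ (e a).2) hxP
        | cast b =>
          rw [f2, f2] at hab
          rw [e.injective (Subtype.ext hab)]
    · rintro ⟨y, hy⟩
      rcases Finset.mem_insert.1 hy with h | h
      · exact ⟨Fin.last t, Subtype.ext (f1.trans h.symm)⟩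
      · exact ⟨(e.symm ⟨y, h⟩).castSucc, Subtype.ext (by rw [f2]; simp)⟩
  refine ⟨t + 1, Equiv.ofBijective f hf, fun j => ?_⟩
  simp only [Equiv.ofBijective_apply]
  induction j using Fin.lastCases with
  | last =>
    refine ⟨i, fun k hk => ?_⟩
    induction k using Fin.lastCases with
    | last => exact absurd hk (lt_irrefl _)
    | cast k => rw [f1, f2]; exact hx _ (e k).2
  | cast j =>
    obtain ⟨i', hi'⟩ := he j
    refine ⟨i', fun k hk => ?_⟩
    induction k using Fin.lastCases with
    | last => exact absurd hk (not_lt.2 (Fin.le_last _))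
    | cast k => rw [f2, f2]; exact hi' k (by simpa using hk)

theorem peelable_log {c : ℕ} (hc : 1 ≤ c) {A : Type} [DecidableEq A] (n : ℕ) :
    ∀ T : Finset (Fin c → A), T.card = n → ∃ P ⊆ T, Peelable P ∧ T.card ≤ 2 ^ P.card := by
  induction n using Nat.strong_induction_on with
  | _ n ih =>
    intro T hn
    by_cases h1 : T.card ≤ 1
    · exact ⟨∅, by simp, peelable_empty, by simpa using h1⟩
    · obtain ⟨x, hx, y, hy, hxy⟩ := Finset.one_lt_card.1 (not_le.1 h1)
      obtain ⟨i, hi⟩ := Function.ne_iff.1 hxy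
      have key : ∃ z ∈ T, 2 * (T.filter (fun w => w i = z i)).card ≤ T.card := by
        have hd : Disjoint (T.filter (fun w => w i = x i)) (T.filter (fun w => w i = y i)) := by
          rw [Finset.disjoint_filter]
          intro w _ h1 h2
          exact hi (h1.symm.trans h2)
        have := Finset.card_le_card (Finset.union_subset
          (Finset.filter_subset (fun w => w i = x i) T)
          (Finset.filter_subset (fun w => w i = y i) T))
        rw [Finset.card_union_of_disjoint hd] at this
        by_cases h : 2 * (T.filter (fun w => w i = x i)).card ≤ T.card
        · exact ⟨x, hx, h⟩
        · exact ⟨y, hy, by omega⟩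
      obtain ⟨z, hz, hzc⟩ := key
      have hs := Finset.card_filter_add_card_filter_not (s := T) (fun w => w i = z i)
      have hpos : 0 < (T.filter (fun w => w i = z i)).card :=
        Finset.card_pos.2 ⟨z, by simp [hz]⟩
      obtain ⟨P, hPT, hP, hPc⟩ := ih _ (by omega) (T.filter (fun w => ¬ w i = z i)) rfl
      have hzP : ∀ w ∈ P, z i ≠ w i := fun w hw h =>
        (Finset.mem_filter.1 (hPT hw)).2 h.symm
      refine ⟨insert z P, ?_, peelable_insert P hP z i hzP, ?_⟩
      · exact Finset.insert_subset hz (hPT.trans (Finset.filter_subset _ _))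
      · rw [Finset.card_insert_of_notMem (fun h => hzP z h rfl), pow_succ]
        omega

/-- Any nonempty set `T` of `d` keys on `c` characters contains a peelable subset of
size at least `max(d^{1/c}, log₂ d)`. -/
theorem peelable_subset_of_keys
    (c : ℕ) (hc : 1 ≤ c) (A : Type) [DecidableEq A]
    (T : Finset (Fin c → A)) (hT : T.Nonempty) :
    ∃ P ⊆ T, Peelable P ∧
      (T.card : ℝ) ^ ((1 : ℝ) / (c : ℝ)) ≤ (P.card : ℝ) ∧
      Real.logb 2 (T.card : ℝ) ≤ (P.card : ℝ) := by
  classical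
  obtain ⟨P, hPm, hmax⟩ := Finset.exists_max_image (T.powerset.filter Peelable) Finset.card
    ⟨∅, by simp [peelable_empty]⟩
  simp only [Finset.mem_filter, Finset.mem_powerset] at hPm hmax
  obtain ⟨hPT, hP⟩ := hPm
  refine ⟨P, hPT, hP, ?_, ?_⟩
  · have hsub : T ⊆ Fintype.piFinset (fun i => P.image (fun y => y i)) := by
      intro x hx
      rw [Fintype.mem_piFinset]
      intro i
      by_contra h
      have hxi : ∀ y ∈ P, x i ≠ y i := fun y hy hxy =>
        h (Finset.mem_image.2 ⟨y, hy, hxy.symm⟩)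
      have := hmax (insert x P) ⟨Finset.insert_subset hx hPT, peelable_insert P hP x i hxi⟩
      rw [Finset.card_insert_of_notMem (fun h => hxi x h rfl)] at this
      omega
    have h1 : T.card ≤ P.card ^ c := by
      refine (Finset.card_le_card hsub).trans ?_
      rw [Fintype.card_piFinset]
      refine (Finset.prod_le_pow_card _ _ P.card (fun i _ => Finset.card_image_le)).trans ?_
      simp
    have h2 : (T.card : ℝ) ≤ (P.card : ℝ) ^ c := by exact_mod_cast h1
    calc (T.card : ℝ) ^ ((1 : ℝ) / (c : ℝ)) ≤ ((P.card : ℝ) ^ c) ^ ((1 : ℝ) / (c : ℝ)) :=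
          Real.rpow_le_rpow (by positivity) h2 (by positivity)
      _ = P.card := by
          rw [one_div]
          exact Real.pow_rpow_inv_natCast (by positivity) (by omega)
  · obtain ⟨Q, hQT, hQ, hQc⟩ := peelable_log hc _ T rfl
    have h1 : T.card ≤ 2 ^ P.card :=
      hQc.trans (Nat.pow_le_pow_right (by norm_num) (hmax Q ⟨hQT, hQ⟩))
    rw [Real.logb_le_iff_le_rpow (by norm_num) (by exact_mod_cast hT.card_pos), Real.rpow_natCast]
    exact_mod_cast h1
end

section
/- Let c ≥ 1 and let S ⊆ Σ^c be a finite set of n keys. Then there exists a linear order ≺ on the position-characters Fin c × Σ such that for every position-character α, the group G_α = {x ∈ S : max_≺(x) = α} satisfies |G_α| ≤ n^{1 − 1/c}. -/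
open Finset

theorem key_step (c : ℕ) (hc : 1 ≤ c) (A : Type) [Fintype A] [DecidableEq A]
    (S : Finset (Fin c → A)) (T : Finset (Fin c × A)) (hT : T.Nonempty) :
    ∃ α ∈ T, ((S.filter (fun x => (∃ i, (i, x i) = α) ∧ ∀ i, (i, x i) ∈ T)).card : ℝ) ≤
      (S.card : ℝ) ^ ((1 : ℝ) - 1 / (c : ℝ)) := by
  by_contra! hcon
  obtain ⟨⟨i, a⟩, hα⟩ := hT
  set n : ℝ := (S.card : ℝ) with hn
  set b : ℝ := n ^ ((1 : ℝ) - 1 / (c : ℝ)) with hb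
  have hc0 : (c : ℝ) ≠ 0 := by positivity
  have hnpos : 0 < n := by
    have h1 := hcon _ hα
    have h0 : 0 ≤ b := by positivity
    have h2 := lt_of_le_of_lt h0 h1
    have h3 : 0 < (S.filter (fun x => (∃ j, (j, x j) = (i, a)) ∧ ∀ i, (i, x i) ∈ T)).card := by
      exact_mod_cast h2
    have h4 := lt_of_lt_of_le h3 (Finset.card_filter_le _ _)
    rw [hn]; exact_mod_cast h4
  have hbpos : 0 < b := Real.rpow_pos_of_pos hnpos _
  have hnb : n = n ^ (1 / (c : ℝ)) * b := by
    rw [hb, ← Real.rpow_add hnpos]; simp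
  let U : Fin c → Finset A := fun j => Finset.univ.filter (fun a => (j, a) ∈ T)
  have hU : ∀ j, ((U j).card : ℝ) ≤ n ^ (1 / (c : ℝ)) := by
    intro j
    have h1 : ((U j).card : ℝ) * b ≤ n := by
      have h2 : ∑ a ∈ U j, (S.filter (fun x => x j = a ∧ ∀ i, (i, x i) ∈ T)).card ≤ S.card := by
        rw [← Finset.card_biUnion]
        · apply Finset.card_le_card
          intro x hx
          simp only [Finset.mem_biUnion, Finset.mem_filter] at hx
          obtain ⟨_, _, h, _⟩ := hx
          exact h
        · intro a _ a' _ haa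
          rw [Function.onFun, Finset.disjoint_left]
          intro x hx hx'
          simp only [Finset.mem_filter] at hx hx'
          exact haa (hx.2.1.symm.trans hx'.2.1)
      have h3 : ∑ a ∈ U j, b ≤
          ∑ a ∈ U j, ((S.filter (fun x => x j = a ∧ ∀ i, (i, x i) ∈ T)).card : ℝ) := by
        apply Finset.sum_le_sum
        intro a ha
        have h4 := (hcon (j, a) (by simpa [U] using ha)).le
        refine h4.trans ?_
        norm_cast
        apply Finset.card_le_card
        intro x hx
        simp only [Finset.mem_filter, Prod.mk.injEq] at hx ⊢
        obtain ⟨h, ⟨k, rfl, hk⟩, h'⟩ := hx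
        exact ⟨h, hk, h'⟩
      rw [Finset.sum_const, nsmul_eq_mul] at h3
      refine h3.trans ?_
      rw [hn]
      exact_mod_cast h2
    rw [hnb] at h1
    exact le_of_mul_le_mul_right h1 hbpos
  have h1 := hcon _ hα
  have h2 : (S.filter (fun x => (∃ j, (j, x j) = (i, a)) ∧ ∀ i, (i, x i) ∈ T)).card ≤
      ∏ j ∈ Finset.univ.erase i, (U j).card := by
    have h3 : S.filter (fun x => (∃ j, (j, x j) = (i, a)) ∧ ∀ i, (i, x i) ∈ T) ⊆
        Fintype.piFinset (fun j => if j = i then {a} else U j) := by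
      intro x hx
      simp only [Finset.mem_filter, Prod.mk.injEq] at hx
      obtain ⟨h, ⟨k, rfl, hk⟩, h'⟩ := hx
      rw [Fintype.mem_piFinset]
      intro j
      by_cases hj : j = k
      · subst hj; simp [hk]
      · simp [hj, U, h' j]
    refine (Finset.card_le_card h3).trans ?_
    rw [Fintype.card_piFinset, ← Finset.mul_prod_erase _ _ (Finset.mem_univ i)]
    simp only [if_true, Finset.card_singleton, one_mul]
    apply le_of_eq
    apply Finset.prod_congr rfl
    intro j hj
    rw [if_neg (Finset.ne_of_mem_erase hj)]
  have h3 : (∏ j ∈ Finset.univ.erase i, ((U j).card : ℝ)) ≤ b := by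
    calc (∏ j ∈ Finset.univ.erase i, ((U j).card : ℝ))
        ≤ ∏ j ∈ Finset.univ.erase i, n ^ (1 / (c : ℝ)) :=
          Finset.prod_le_prod (fun _ _ => Nat.cast_nonneg _) (fun j _ => hU j)
      _ = b := by
          rw [Finset.prod_const, Finset.card_erase_of_mem (Finset.mem_univ i), Finset.card_univ,
            Fintype.card_fin, ← Real.rpow_natCast, ← Real.rpow_mul hnpos.le, hb]
          congr 1
          rw [Nat.cast_sub hc]
          field_simp
          simp
  have h4 : ((S.filter (fun x => (∃ j, (j, x j) = (i, a)) ∧ ∀ i, (i, x i) ∈ T)).card : ℝ) ≤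
      ∏ j ∈ Finset.univ.erase i, ((U j).card : ℝ) := by exact_mod_cast h2
  linarith

theorem order_aux (c : ℕ) (hc : 1 ≤ c) (A : Type) [Fintype A] [DecidableEq A]
    (S : Finset (Fin c → A)) (m : ℕ) : ∀ T : Finset (Fin c × A), T.card = m →
    ∃ π : Fin c × A → ℕ, Set.InjOn π T ∧ (∀ α ∈ T, π α < m) ∧
      ∀ α ∈ T, ((S.filter (fun x => (∃ i, (i, x i) = α) ∧
        ∀ i, (i, x i) ∈ T ∧ π (i, x i) ≤ π α)).card : ℝ) ≤
          (S.card : ℝ) ^ ((1 : ℝ) - 1 / (c : ℝ)) := by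
  induction m with
  | zero =>
    intro T hT
    rw [Finset.card_eq_zero] at hT
    subst hT
    exact ⟨fun _ => 0, by simp, by simp, by simp⟩
  | succ m ih =>
    intro T hT
    obtain ⟨α, hα, hle⟩ := key_step c hc A S T (Finset.card_pos.mp (by omega))
    obtain ⟨π, hinj, hlt, hgr⟩ := ih (T.erase α) (by rw [Finset.card_erase_of_mem hα]; omega)
    have hlt' : ∀ β ∈ T, β ≠ α → π β < m := fun β hβ h => hlt β (Finset.mem_erase.2 ⟨h, hβ⟩)
    refine ⟨Function.update π α m, ?_, ?_, ?_⟩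
    · intro x hx y hy hxy
      by_cases h1 : x = α <;> by_cases h2 : y = α
      · rw [h1, h2]
      · subst h1
        rw [Function.update_self, Function.update_of_ne h2] at hxy
        have := hlt' y hy h2
        omega
      · subst h2
        rw [Function.update_self, Function.update_of_ne h1] at hxy
        have := hlt' x hx h1
        omega
      · rw [Function.update_of_ne h1, Function.update_of_ne h2] at hxy
        exact hinj (by simpa [h1] using hx) (by simpa [h2] using hy) hxy
    · intro β hβ
      by_cases h : β = α
      · subst h; simp
      · rw [Function.update_of_ne h]
        have := hlt' β hβ h
        omega
    · intro β hβ
      by_cases h : β = α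
      · subst h
        refine le_trans ?_ hle
        norm_cast
        apply Finset.card_le_card
        intro x hx
        simp only [Finset.mem_filter] at hx ⊢
        exact ⟨hx.1, hx.2.1, fun i => (hx.2.2 i).1⟩
      · refine le_trans ?_ (hgr β (Finset.mem_erase.2 ⟨h, hβ⟩))
        norm_cast
        apply Finset.card_le_card
        intro x hx
        simp only [Finset.mem_filter] at hx ⊢
        refine ⟨hx.1, hx.2.1, fun i => ?_⟩
        obtain ⟨h1, h2⟩ := hx.2.2 i
        rw [Function.update_of_ne h] at h2
        have h3 : (i, x i) ≠ α := by
          intro h4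
          rw [h4, Function.update_self] at h2
          have := hlt' β hβ h
          omega
        rw [Function.update_of_ne h3] at h2
        exact ⟨Finset.mem_erase.2 ⟨h3, h1⟩, h2⟩

/-- There is a linear order on position-characters (represented by an injective
ranking `π : Fin c × A → ℕ`) such that every group
`G_α = {x ∈ S : max_≺(x) = α}` has size at most `n^{1-1/c}` (Lemma 2 of the paper).
Here `max_≺(x) = α` means that `α` is a position-character of `x` and every
position-character of `x` has rank at most that of `α`. -/
theorem exists_order_with_small_groups
    (c : ℕ) (hc : 1 ≤ c) (A : Type) [Fintype A] [DecidableEq A] (S : Finset (Fin c → A)) :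
    ∃ π : Fin c × A → ℕ, Function.Injective π ∧
      ∀ α : Fin c × A,
        ((S.filter (fun x => (∃ i, (i, x i) = α) ∧ ∀ i, π (i, x i) ≤ π α)).card : ℝ) ≤
          (S.card : ℝ) ^ ((1 : ℝ) - 1 / (c : ℝ)) := by
  obtain ⟨π, hinj, _, hgr⟩ := order_aux c hc A S _ Finset.univ rfl
  refine ⟨π, fun x y h => hinj (by simp) (by simp) h, fun α => ?_⟩
  simpa using hgr α (Finset.mem_univ α)
end

section
/- Let c ≥ 1 and γ > 0 be constants, let Σ be a finite alphabet, let S ⊆ Σ^c be a set of n keys, and let m = 2^b with m ≥ n^{1−1/(2c)}. Let ≺ be a linear order on the position-characters Fin c × Σ such that every group G_α = {x ∈ S : max_≺(x) = α} satisfies |G_α| ≤ n^{1−1/c}. Let d = min{ (2c(3+γ))^c , 2^{2c(3+γ)} }. Then under a random simple tabulation hash function h into m bins, with probability at least 1 − m^{−γ}, every group G_α is d-bounded, i.e., for every position-character α and every bin B ∈ (ZMod 2)^b, |{x ∈ G_α : h(x) = B}| ≤ d. -/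
open Finset

inductive TabPeel {c : ℕ} {A : Type} [DecidableEq A] : Finset (Fin c → A) → Prop
  | empty : TabPeel ∅
  | cons (x : Fin c → A) (s : Finset (Fin c → A)) (i : Fin c)
      (h : ∀ y ∈ s, y i ≠ x i) (hs : TabPeel s) : TabPeel (insert x s)

lemma TabPeel.exists_sub {c : ℕ} {A : Type} [DecidableEq A] {s : Finset (Fin c → A)}
    (hs : TabPeel s) : ∀ t ≤ s.card, ∃ s' ⊆ s, TabPeel s' ∧ s'.card = t := by
  induction hs with
  | empty =>
    intro t ht
    exact ⟨∅, by simp, TabPeel.empty, by simp at ht; simp [ht]⟩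
  | cons x s i h hs ih =>
    intro t ht
    by_cases h1 : t ≤ s.card
    · obtain ⟨s', h2, h3, h4⟩ := ih t h1
      exact ⟨s', h2.trans (subset_insert _ _), h3, h4⟩
    · refine ⟨_, subset_rfl, TabPeel.cons x s i h hs, ?_⟩
      have := card_insert_le x s
      omega

lemma TabPeel.of_injOn {c : ℕ} {A : Type} [DecidableEq A] (i : Fin c) (s : Finset (Fin c → A))
    (h : Set.InjOn (fun x : Fin c → A => x i) s) : TabPeel s := by
  induction s using Finset.induction_on with
  | empty => exact TabPeel.empty
  | insert x s hx ih =>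
    refine TabPeel.cons x s i ?_ (ih (h.mono (by simp)))
    intro y hy he
    have : y = x := h (by simp [hy]) (by simp) he
    exact hx (this ▸ hy)

lemma tab_peel_root {c : ℕ} (hc : 1 ≤ c) {A : Type} [DecidableEq A] (X : Finset (Fin c → A)) :
    ∃ s ⊆ X, TabPeel s ∧ X.card ≤ s.card ^ c := by
  obtain ⟨i, -, hi⟩ := Finset.exists_max_image (univ : Finset (Fin c))
    (fun i => (X.image (fun x => x i)).card) ⟨⟨0, hc⟩, mem_univ _⟩
  have hch : ∀ a ∈ X.image (fun x => x i), ∃ x ∈ X, x i = a := by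
    intro a ha
    simpa using ha
  choose! f hf1 hf2 using hch
  have hinj : Set.InjOn f (X.image (fun x => x i) : Finset A) := by
    intro a ha a' ha' h
    rw [← hf2 a ha, ← hf2 a' ha', h]
  refine ⟨(X.image (fun x => x i)).image f, ?_, ?_, ?_⟩
  · intro y hy
    obtain ⟨a, ha, rfl⟩ := mem_image.1 hy
    exact hf1 a ha
  · apply TabPeel.of_injOn i
    intro y hy y' hy' h
    obtain ⟨a, ha, rfl⟩ := mem_image.1 (mem_coe.1 hy)
    obtain ⟨a', ha', rfl⟩ := mem_image.1 (mem_coe.1 hy')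
    simp only [hf2 a ha, hf2 a' ha'] at h
    rw [h]
  · rw [card_image_of_injOn hinj]
    have h1 : X ⊆ Fintype.piFinset (fun j => X.image (fun x => x j)) := by
      intro x hx
      rw [Fintype.mem_piFinset]
      intro j
      exact mem_image_of_mem _ hx
    calc X.card ≤ _ := card_le_card h1
      _ = ∏ j, (X.image (fun x => x j)).card := Fintype.card_piFinset _
      _ ≤ ∏ j : Fin c, (X.image (fun x => x i)).card :=
          Finset.prod_le_prod' (fun j hj => hi j hj)
      _ = _ := by simp

lemma tab_peel_log {c : ℕ} {A : Type} [DecidableEq A] (N : ℕ) :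
    ∀ X : Finset (Fin c → A), X.card ≤ N → ∃ s ⊆ X, TabPeel s ∧ X.card ≤ 2 ^ s.card := by
  induction N using Nat.strong_induction_on with
  | _ N ih =>
  intro X hX
  by_cases h1 : X.card ≤ 1
  · exact ⟨∅, by simp, TabPeel.empty, by simpa using h1⟩
  · obtain ⟨x, hx, y, hy, hxy⟩ := Finset.one_lt_card.1 (not_le.1 h1)
    obtain ⟨i, hi⟩ := Function.ne_iff.1 hxy
    have key : ∃ z ∈ X, 2 * (X.filter (fun w => w i = z i)).card ≤ X.card := by
      by_contra hcon
      push Not at hcon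
      have a1 := hcon x hx
      have a2 := hcon y hy
      have hd : Disjoint (X.filter (fun w => w i = x i)) (X.filter (fun w => w i = y i)) := by
        rw [Finset.disjoint_filter]
        intro w _ h h'
        exact hi (h.symm.trans h')
      have a3 := card_union_of_disjoint hd
      have a4 : ((X.filter (fun w => w i = x i)) ∪ (X.filter (fun w => w i = y i))).card ≤ X.card :=
        card_le_card (union_subset (filter_subset _ _) (filter_subset _ _))
      omega
    obtain ⟨z, hz, hz2⟩ := key
    have a5 := Finset.card_filter_add_card_filter_not (s := X) (fun w => w i = z i)
    have a6 : 0 < (X.filter (fun w => w i = z i)).card :=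
      card_pos.2 ⟨z, by simp [hz]⟩
    obtain ⟨s, hs1, hs2, hs3⟩ := ih (X.filter (fun w => ¬ w i = z i)).card (by omega)
      (X.filter (fun w => ¬ w i = z i)) le_rfl
    have hne : ∀ w ∈ s, w i ≠ z i := fun w hw => (mem_filter.1 (hs1 hw)).2
    refine ⟨insert z s, ?_, TabPeel.cons z s i hne hs2, ?_⟩
    · exact insert_subset hz (hs1.trans (filter_subset _ _))
    · rw [card_insert_of_notMem (fun h => hne z h rfl), pow_succ]
      omega

open Classical in
lemma tab_peel_count {c b : ℕ} {A : Type} [Fintype A] [DecidableEq A]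
    (B : Fin b → ZMod 2) {s : Finset (Fin c → A)} (hs : TabPeel s) :
    (univ.filter (fun T : Fin c → A → (Fin b → ZMod 2) => ∀ y ∈ s, tabHash T y = B)).card
      * (2 ^ b) ^ s.card ≤ Fintype.card (Fin c → A → (Fin b → ZMod 2)) := by
  induction hs with
  | empty => simp
  | cons x s i h hs ih =>
    refine le_trans ?_ ih
    rw [card_insert_of_notMem (fun h' => h x h' rfl), pow_succ', ← mul_assoc]
    refine Nat.mul_le_mul_right _ ?_
    have hcard : (univ : Finset (Fin b → ZMod 2)).card = 2 ^ b := by simp [ZMod.card]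
    rw [← hcard, ← card_product]
    have hself : ∀ (T : Fin c → A → (Fin b → ZMod 2)) v,
        tabHash (fun j a => T j a + if j = i ∧ a = x i then v else 0) x = tabHash T x + v := by
      intro T v
      unfold tabHash
      rw [Finset.sum_add_distrib]
      congr 1
      rw [Finset.sum_eq_single i]
      · simp
      · intro j _ hj; simp [hj]
      · simp
    have hoth : ∀ (T : Fin c → A → (Fin b → ZMod 2)) v, ∀ y ∈ s,
        tabHash (fun j a => T j a + if j = i ∧ a = x i then v else 0) y = tabHash T y := by
      intro T v y hy
      unfold tabHash
      refine Finset.sum_congr rfl ?_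
      intro j _
      beta_reduce
      rw [if_neg, add_zero]
      rintro ⟨rfl, h2⟩
      exact h y hy h2
    refine Finset.card_le_card_of_injOn
      (fun p => fun j a => p.1 j a + if j = i ∧ a = x i then p.2 else 0) ?_ ?_
    · rintro ⟨T, v⟩ hT
      simp only [coe_product, Set.mem_prod, mem_coe, mem_filter, mem_univ, true_and,
        and_true] at hT ⊢
      intro y hy
      rw [hoth T v y hy]
      exact hT y (mem_insert_of_mem hy)
    · rintro ⟨T, v⟩ hT ⟨T', v'⟩ hT' he
      simp only [coe_product, Set.mem_prod, mem_coe, mem_filter, mem_univ, true_and,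
        and_true] at hT hT' he
      have e1 := hself T v
      rw [he, hself T' v', hT x (mem_insert_self _ _), hT' x (mem_insert_self _ _)] at e1
      have e2 : v = v' := (add_left_cancel e1).symm
      subst e2
      have : T = T' := by
        funext j a
        exact add_right_cancel (congrFun (congrFun he j) a)
      rw [this]

lemma tab_final_ineq (c : ℕ) (hc : 1 ≤ c) (γ : ℝ) (hγ : 0 < γ) (n t : ℕ) (hn : 1 ≤ n) (m : ℝ)
    (hm : m ≥ (n : ℝ) ^ ((1 : ℝ) - 1 / (2 * (c : ℝ))))
    (ht : 2 * (c : ℝ) * (3 + γ) ≤ t) :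
    (n : ℝ) * ((n : ℝ) ^ ((1 : ℝ) - 1 / (c : ℝ))) ^ (t - 1) * m ≤ m ^ (-γ) * m ^ t := by
  have hc' : (1 : ℝ) ≤ c := by exact_mod_cast hc
  have hn' : (1 : ℝ) ≤ n := by exact_mod_cast hn
  have hn0 : (0 : ℝ) < n := by linarith
  have hm0 : 0 < m := lt_of_lt_of_le (Real.rpow_pos_of_pos hn0 _) hm
  have ht1 : (1 : ℝ) ≤ t := by nlinarith
  have ht1' : 1 ≤ t := by exact_mod_cast ht1
  have hcast : ((t - 1 : ℕ) : ℝ) = t - 1 := by push_cast [ht1']; ring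
  have hexp : 0 ≤ (t : ℝ) - 1 - γ := by nlinarith
  have h1 : (n : ℝ) * ((n : ℝ) ^ ((1 : ℝ) - 1 / (c : ℝ))) ^ (t - 1)
      = (n : ℝ) ^ (1 + (1 - 1 / (c : ℝ)) * (t - 1)) := by
    rw [Real.rpow_add hn0, Real.rpow_one, Real.rpow_mul hn0.le, ← hcast, Real.rpow_natCast]
  have h2 : m ^ (-γ) * m ^ t = m ^ ((t : ℝ) - 1 - γ) * m := by
    rw [← Real.rpow_natCast m t, ← Real.rpow_add hm0, ← Real.rpow_add_one hm0.ne']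
    congr 1; ring
  rw [h1, h2]
  refine mul_le_mul_of_nonneg_right ?_ hm0.le
  calc (n : ℝ) ^ (1 + (1 - 1 / (c : ℝ)) * (t - 1))
      ≤ (n : ℝ) ^ (((1 : ℝ) - 1 / (2 * (c : ℝ))) * ((t : ℝ) - 1 - γ)) := by
        refine Real.rpow_le_rpow_of_exponent_le hn' ?_
        have e : ((1 : ℝ) - 1 / (2 * (c : ℝ))) * ((t : ℝ) - 1 - γ)
            - (1 + (1 - 1 / (c : ℝ)) * (t - 1))
            = ((t - 1) - 2 * c - (2 * c - 1) * γ) / (2 * c) := by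
          field_simp; ring
        have e2 : 0 ≤ (((t : ℝ) - 1) - 2 * c - (2 * c - 1) * γ) / (2 * c) := by
          apply div_nonneg <;> nlinarith
        linarith
    _ = ((n : ℝ) ^ ((1 : ℝ) - 1 / (2 * (c : ℝ)))) ^ ((t : ℝ) - 1 - γ) := Real.rpow_mul hn0.le _ _
    _ ≤ m ^ ((t : ℝ) - 1 - γ) := Real.rpow_le_rpow (by positivity) hm hexp

set_option maxHeartbeats 2000000 in
/-- Lemma 3 of the paper: with `m ≥ n^{1-1/(2c)}` bins and an ordering of the
position-characters (given by an injective ranking `π`) whose groups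
`G_α = {x ∈ S : max_≺(x) = α}` all have size at most `n^{1-1/c}`, with probability
at least `1 - m^{-γ}` every group is `d`-bounded for
`d = min((2c(3+γ))^c, 2^{2c(3+γ)})`: no bin gets more than `d` keys of any group. -/
theorem simple_tabulation_groups_d_bounded
    (c : ℕ) (hc : 1 ≤ c) (γ : ℝ) (hγ : 0 < γ)
    (A : Type) [Fintype A] [DecidableEq A] (b : ℕ) (S : Finset (Fin c → A))
    (hm : ((2 : ℝ) ^ b) ≥ (S.card : ℝ) ^ ((1 : ℝ) - 1 / (2 * (c : ℝ))))
    (π : Fin c × A → ℕ) (hπ : Function.Injective π)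
    (hgroups : ∀ α : Fin c × A,
      ((S.filter (fun x => (∃ i, (i, x i) = α) ∧ ∀ i, π (i, x i) ≤ π α)).card : ℝ) ≤
        (S.card : ℝ) ^ ((1 : ℝ) - 1 / (c : ℝ))) :
    tabPr c b A (fun T =>
        ∀ (α : Fin c × A) (B : Fin b → ZMod 2),
          (((S.filter (fun x => (∃ i, (i, x i) = α) ∧ ∀ i, π (i, x i) ≤ π α)).filter
              (fun x => tabHash T x = B)).card : ℝ) ≤
            min (((2 * (c : ℝ)) * (3 + γ)) ^ c) ((2 : ℝ) ^ (2 * (c : ℝ) * (3 + γ)))) ≥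
      1 - ((2 : ℝ) ^ b) ^ (-γ) := by
  classical
  set G : Fin c × A → Finset (Fin c → A) := fun α =>
    S.filter (fun x => (∃ i, (i, x i) = α) ∧ ∀ i, π (i, x i) ≤ π α) with hG
  set u : ℝ := 2 * (c : ℝ) * (3 + γ) with hu
  have hc' : (1 : ℝ) ≤ c := by exact_mod_cast hc
  have hu0 : 0 < u := by positivity
  set t : ℕ := ⌈u⌉₊ with htdef
  have htu : u ≤ t := Nat.le_ceil u
  have ht1 : 1 ≤ t := Nat.ceil_pos.2 hu0
  set m : ℝ := (2 : ℝ) ^ b with hmdef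
  have hm0 : 0 < m := by positivity
  set P : (Fin c → A → (Fin b → ZMod 2)) → Prop := fun T =>
    ∀ (α : Fin c × A) (B : Fin b → ZMod 2),
      (((G α).filter (fun x => tabHash T x = B)).card : ℝ) ≤ min (u ^ c) ((2 : ℝ) ^ u) with hP
  change tabPr c b A P ≥ _
  set Bad := univ.filter (fun T => ¬ P T) with hBad
  set W : ℕ := Fintype.card (Fin c → A → (Fin b → ZMod 2)) with hW
  have hWpos : 0 < W := Fintype.card_pos
  have hpr : tabPr c b A P = 1 - (Bad.card : ℝ) / W := by
    unfold tabPr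
    rw [Nat.card_eq_fintype_card, Nat.card_eq_fintype_card, Fintype.card_subtype]
    have := Finset.card_filter_add_card_filter_not
      (s := (univ : Finset (Fin c → A → (Fin b → ZMod 2)))) P
    rw [card_univ] at this
    have h2 : ((univ.filter P).card : ℝ) + Bad.card = W := by exact_mod_cast this
    have : (W : ℝ) ≠ 0 := by positivity
    rw [eq_sub_iff_add_eq, ← hW, ← add_div, div_eq_one_iff_eq this]
    exact h2
  rw [hpr]
  suffices hs : (Bad.card : ℝ) / W ≤ m ^ (-γ) by linarith
  -- covering
  have hcov : Bad ⊆ (univ : Finset (Fin c × A)).biUnion (fun α =>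
      (univ : Finset (Fin b → ZMod 2)).biUnion (fun B =>
        (((G α).powersetCard t).filter TabPeel).biUnion (fun s =>
          univ.filter (fun T => ∀ y ∈ s, tabHash T y = B)))) := by
    intro T hT
    have hT2 : ¬ P T := (mem_filter.1 hT).2
    simp only [hP] at hT2
    push Not at hT2
    obtain ⟨α, B, hlt⟩ := hT2
    set X := (G α).filter (fun x => tabHash T x = B) with hX
    have : ∃ s ⊆ X, TabPeel s ∧ t ≤ s.card := by
      rcases min_lt_iff.1 hlt with h | h
      · obtain ⟨s, h1, h2, h3⟩ := tab_peel_root hc X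
        refine ⟨s, h1, h2, Nat.ceil_le.2 ?_⟩
        have h4 : (X.card : ℝ) ≤ (s.card : ℝ) ^ c := by exact_mod_cast h3
        exact (lt_of_pow_lt_pow_left₀ c (Nat.cast_nonneg _) (h.trans_le h4)).le
      · obtain ⟨s, h1, h2, h3⟩ := tab_peel_log X.card X le_rfl
        refine ⟨s, h1, h2, Nat.ceil_le.2 ?_⟩
        have h4 : (X.card : ℝ) ≤ (2 : ℝ) ^ (s.card : ℝ) := by
          rw [Real.rpow_natCast]; exact_mod_cast h3
        exact ((Real.rpow_lt_rpow_left_iff (by norm_num)).1 (h.trans_le h4)).le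
    obtain ⟨s, h1, h2, h3⟩ := this
    obtain ⟨s', h4, h5, h6⟩ := h2.exists_sub t h3
    simp only [mem_biUnion, mem_univ, true_and, mem_filter, mem_powersetCard]
    exact ⟨α, B, s', ⟨⟨fun y hy => (mem_filter.1 (h1 (h4 hy))).1, h6⟩, h5⟩,
      fun y hy => (mem_filter.1 (h1 (h4 hy))).2⟩
  have hcard : (Bad.card : ℝ) * m ^ t ≤ (∑ α, ((G α).card : ℝ) ^ t) * m * W := by
    have h1 : Bad.card * (2 ^ b) ^ t ≤ (∑ α, (G α).card ^ t) * 2 ^ b * W := by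
      have hB : (univ : Finset (Fin b → ZMod 2)).card = 2 ^ b := by simp [ZMod.card]
      calc Bad.card * (2 ^ b) ^ t ≤ (∑ α, ∑ B : Fin b → ZMod 2,
            ∑ s ∈ ((G α).powersetCard t).filter TabPeel,
              (univ.filter (fun T : Fin c → A → (Fin b → ZMod 2) =>
                ∀ y ∈ s, tabHash T y = B)).card) * (2 ^ b) ^ t := by
            refine Nat.mul_le_mul_right _ ((card_le_card hcov).trans ?_)
            refine card_biUnion_le.trans (sum_le_sum fun α _ => ?_)
            refine card_biUnion_le.trans (sum_le_sum fun B _ => ?_)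
            exact card_biUnion_le
        _ = ∑ α, ∑ B : Fin b → ZMod 2,
            ∑ s ∈ ((G α).powersetCard t).filter TabPeel,
              (univ.filter (fun T : Fin c → A → (Fin b → ZMod 2) =>
                ∀ y ∈ s, tabHash T y = B)).card * (2 ^ b) ^ t := by
            simp only [sum_mul]
        _ ≤ ∑ α, ∑ B : Fin b → ZMod 2,
            ∑ s ∈ ((G α).powersetCard t).filter TabPeel, W := by
            refine sum_le_sum fun α _ => sum_le_sum fun B _ => sum_le_sum fun s hs => ?_
            have hs' := mem_filter.1 hs
            have := tab_peel_count B hs'.2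
            rw [(mem_powersetCard.1 hs'.1).2] at this
            exact this
        _ ≤ ∑ α, ∑ B : Fin b → ZMod 2, (G α).card ^ t * W := by
            refine sum_le_sum fun α _ => sum_le_sum fun B _ => ?_
            rw [sum_const, smul_eq_mul]
            refine Nat.mul_le_mul_right _ ((card_filter_le _ _).trans ?_)
            rw [card_powersetCard]
            exact Nat.choose_le_pow _ _
        _ = (∑ α, (G α).card ^ t) * 2 ^ b * W := by
            simp only [sum_const, hB, smul_eq_mul, sum_mul]
            refine sum_congr rfl fun α _ => ?_
            ring
    rw [hmdef]
    exact_mod_cast h1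
  have hsumG : ∑ α, (G α).card ≤ S.card := by
    rw [← card_biUnion]
    · exact card_le_card (biUnion_subset.2 fun α _ => filter_subset _ _)
    · intro α _ β _ hne
      change Disjoint (G α) (G β)
      rw [Finset.disjoint_left]
      intro x h1 h2
      obtain ⟨-, ⟨i, hi⟩, h1b⟩ := mem_filter.1 h1
      obtain ⟨-, ⟨j, hj⟩, h2b⟩ := mem_filter.1 h2
      have e1 := h2b i
      have e2 := h1b j
      rw [hi] at e1
      rw [hj] at e2
      exact hne (hπ (le_antisymm e1 e2))
  set K : ℝ := (S.card : ℝ) ^ ((1 : ℝ) - 1 / (c : ℝ)) with hK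
  have hK0 : 0 ≤ K := by positivity
  have hsum : ∑ α, ((G α).card : ℝ) ^ t ≤ S.card * K ^ (t - 1) := by
    calc ∑ α, ((G α).card : ℝ) ^ t ≤ ∑ α, ((G α).card : ℝ) * K ^ (t - 1) := by
          refine sum_le_sum fun α _ => ?_
          obtain ⟨k, hk⟩ : ∃ k, t = k + 1 := ⟨t - 1, by omega⟩
          rw [hk, pow_succ', Nat.add_sub_cancel]
          exact mul_le_mul_of_nonneg_left
            (pow_le_pow_left₀ (by positivity) (hgroups α) _) (by positivity)
      _ = (∑ α, ((G α).card : ℝ)) * K ^ (t - 1) := by rw [sum_mul]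
      _ ≤ _ := mul_le_mul_of_nonneg_right (by exact_mod_cast hsumG) (by positivity)
  have hfin : (S.card : ℝ) * K ^ (t - 1) * m ≤ m ^ (-γ) * m ^ t := by
    rcases Nat.eq_zero_or_pos S.card with h0 | h0
    · rw [h0]; simp; positivity
    · exact tab_final_ineq c hc γ hγ S.card t h0 m hm htu
  rw [div_le_iff₀ (by exact_mod_cast hWpos)]
  have hmt : 0 < m ^ t := by positivity
  refine le_of_mul_le_mul_right ?_ hmt
  calc (Bad.card : ℝ) * m ^ t ≤ (∑ α, ((G α).card : ℝ) ^ t) * m * W := hcard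
    _ ≤ (S.card * K ^ (t - 1)) * m * W := by gcongr
    _ ≤ (m ^ (-γ) * m ^ t) * W := by gcongr
    _ = m ^ (-γ) * W * m ^ t := by ring
end

section
/- Let p and k be real numbers with 0 < p ≤ 1, k > 0, and p·k ≤ √2 − 1. Then 1 − p·k > (1 − p)^{(1 + p·k)·k}, where the right-hand side is the real power (1−p) raised to the (possibly non-integral) exponent (1+pk)·k. -/
/-- Gerber-type inequality (Lemma 9 of the paper): for `0 < p ≤ 1`, `k > 0` with
`p·k ≤ √2 − 1`, we have `1 − p·k > (1 − p)^{(1 + p·k)·k}`, where the right-hand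
side is a real (possibly non-integral) power. -/
theorem one_sub_mul_gt_rpow
    (p k : ℝ) (hp : 0 < p) (hp1 : p ≤ 1) (hk : 0 < k)
    (hpk : p * k ≤ Real.sqrt 2 - 1) :
    1 - p * k > (1 - p) ^ ((1 + p * k) * k) := by

  have hx : 0 < p * k := mul_pos hp hk
  have hs : Real.sqrt 2 ^ 2 = 2 := Real.sq_sqrt (by norm_num)
  have hs0 : 0 ≤ Real.sqrt 2 := Real.sqrt_nonneg 2
  have ht : 0 < (1 + p * k) * k := by positivity
  have h1 : (1 - p) ^ ((1 + p * k) * k) < Real.exp (-p) ^ ((1 + p * k) * k) := by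
    apply Real.rpow_lt_rpow (by linarith) _ ht
    have := Real.add_one_lt_exp (x := -p) (by linarith)
    linarith
  rw [← Real.exp_mul] at h1
  have e : -p * ((1 + p * k) * k) = -(p * k + (p * k) ^ 2) := by ring
  rw [e, Real.exp_neg] at h1
  generalize p * k = x at *
  have hx2 : x ^ 2 ≤ 1 - 2 * x := by nlinarith
  have hq := Real.quadratic_le_exp_of_nonneg (x := x + x ^ 2) (by positivity)
  have hx1 : 0 < 1 - x := by nlinarith
  have h3 : 1 ≤ (1 - x) * (1 + (x + x ^ 2) + (x + x ^ 2) ^ 2 / 2) := by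
    have : 0 ≤ 1 - x - x ^ 2 - x ^ 3 := by nlinarith
    nlinarith [mul_nonneg (sq_nonneg x) this]
  have h4 : (Real.exp (x + x ^ 2))⁻¹ ≤ 1 - x := by
    rw [inv_le_iff_one_le_mul₀ (Real.exp_pos _)]
    exact h3.trans (mul_le_mul_of_nonneg_left hq hx1.le)
  linarith
end

section
/- Let (Ω, F, P) be a probability space and let X_1, …, X_n : Ω → ℝ be (possibly dependent) random variables with 0 ≤ X_i ≤ 1 almost surely. Suppose that for each i there is a constant μ_i such that the conditional expectation of X_i given the σ-algebra generated by X_1, …, X_{i−1} equals μ_i almost surely. Let X = X_1 + ⋯ + X_n and μ = μ_1 + ⋯ + μ_n. Then for every δ > 0: P[X ≥ (1+δ)·μ] ≤ ( e^δ / (1+δ)^{1+δ} )^μ and P[X ≤ (1−δ)·μ] ≤ ( e^{−δ} / (1−δ)^{1−δ} )^μ. -/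
open MeasureTheory ProbabilityTheory

lemma chern_exp_le (t x : ℝ) (hx : x ∈ Set.Icc (0 : ℝ) 1) :
    Real.exp (t * x) ≤ 1 + (Real.exp t - 1) * x := by
  have h := convexOn_exp.2 (Set.mem_univ (0 : ℝ)) (Set.mem_univ t)
    (show (0 : ℝ) ≤ 1 - x by linarith [hx.2]) hx.1 (by ring)
  simp only [smul_eq_mul, mul_zero, zero_add, Real.exp_zero] at h
  rw [mul_comm t x]
  linarith

lemma chern_int {Ω : Type} [MeasurableSpace Ω] (P : Measure Ω) [IsProbabilityMeasure P]
    {n : ℕ} (X : Fin n → Ω → ℝ) (hmeas : ∀ i, Measurable (X i))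
    (hbdd : ∀ i, ∀ᵐ ω ∂P, X i ω ∈ Set.Icc (0 : ℝ) 1) (t : ℝ) (s : Finset (Fin n)) :
    Integrable (fun ω => Real.exp (t * ∑ i ∈ s, X i ω)) P := by
  refine Integrable.of_bound (C := Real.exp (|t| * n)) ?_ ?_
  · have : Measurable (fun ω => ∑ i ∈ s, X i ω) := Finset.measurable_sum _ (fun i _ => hmeas i)
    exact (Real.measurable_exp.comp (this.const_mul t)).aestronglyMeasurable
  · filter_upwards [ae_all_iff.2 hbdd] with ω h
    rw [Real.norm_eq_abs, Real.abs_exp, Real.exp_le_exp]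
    have h0 : 0 ≤ ∑ i ∈ s, X i ω := Finset.sum_nonneg (fun i _ => (h i).1)
    have h1 : ∑ i ∈ s, X i ω ≤ n := by
      calc ∑ i ∈ s, X i ω ≤ ∑ i ∈ s, (1 : ℝ) := Finset.sum_le_sum (fun i _ => (h i).2)
        _ = (s.card : ℝ) := by simp
        _ ≤ n := by exact_mod_cast (by simpa using s.card_le_univ)
    calc t * ∑ i ∈ s, X i ω ≤ |t| * ∑ i ∈ s, X i ω :=
          mul_le_mul_of_nonneg_right (le_abs_self t) h0
      _ ≤ |t| * n := mul_le_mul_of_nonneg_left h1 (abs_nonneg t)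

lemma chern_step {Ω : Type} {m : MeasurableSpace Ω} [m0 : MeasurableSpace Ω] (P : Measure Ω) [IsProbabilityMeasure P]
    (hm : m ≤ m0) (Y X : Ω → ℝ) (c t : ℝ)
    (hX : Measurable X) (hb : ∀ᵐ ω ∂P, X ω ∈ Set.Icc (0 : ℝ) 1)
    (hc : P[X | m] =ᵐ[P] fun _ => c) (hY : StronglyMeasurable[m] Y) (hYi : Integrable Y P)
    (hY0 : ∀ ω, 0 ≤ Y ω) (hi : Integrable (fun ω => Y ω * Real.exp (t * X ω)) P) :
    ∫ ω, Y ω * Real.exp (t * X ω) ∂P ≤ (∫ ω, Y ω ∂P) * Real.exp ((Real.exp t - 1) * c) := by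
  have hXb : ∀ᵐ ω ∂P, ‖X ω‖ ≤ 1 := by
    filter_upwards [hb] with ω h
    rw [Real.norm_eq_abs, abs_of_nonneg h.1]; exact h.2
  have hXi : Integrable X P := Integrable.of_bound hX.aestronglyMeasurable 1 hXb
  have hYX : Integrable (Y * X) P := hYi.mul_bdd hX.aestronglyMeasurable hXb
  have e1 : ∫ ω, Y ω * X ω ∂P = c * ∫ ω, Y ω ∂P := by
    calc ∫ ω, Y ω * X ω ∂P = ∫ ω, (P[Y * X | m]) ω ∂P := (integral_condExp hm).symm
      _ = ∫ ω, c * Y ω ∂P := by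
        apply integral_congr_ae
        filter_upwards [condExp_mul_of_stronglyMeasurable_left hY hYX hXi, hc] with ω h1 h2
        rw [h1, Pi.mul_apply, h2, mul_comm]
      _ = c * ∫ ω, Y ω ∂P := integral_const_mul _ _
  have hYX' : Integrable (fun ω => (Real.exp t - 1) * (Y ω * X ω)) P := hYX.const_mul _
  calc ∫ ω, Y ω * Real.exp (t * X ω) ∂P
      ≤ ∫ ω, (Y ω + (Real.exp t - 1) * (Y ω * X ω)) ∂P := by
        apply integral_mono_ae hi (hYi.add hYX')
        filter_upwards [hb] with ω h
        have := mul_le_mul_of_nonneg_left (chern_exp_le t _ h) (hY0 ω)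
        simp only [Pi.add_apply] at *
        linarith
    _ = (∫ ω, Y ω ∂P) * (1 + (Real.exp t - 1) * c) := by
        rw [integral_add hYi hYX', integral_const_mul, e1]; ring
    _ ≤ _ := by
        apply mul_le_mul_of_nonneg_left _ (integral_nonneg hY0)
        linarith [Real.add_one_le_exp ((Real.exp t - 1) * c)]

lemma chern_mgf {Ω : Type} [MeasurableSpace Ω] (P : Measure Ω) [IsProbabilityMeasure P]
    (n : ℕ) (X : Fin n → Ω → ℝ) (μi : Fin n → ℝ)
    (hmeas : ∀ i, Measurable (X i))
    (hbdd : ∀ i, ∀ᵐ ω ∂P, X i ω ∈ Set.Icc (0 : ℝ) 1)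
    (hcond : ∀ i : Fin n,
      P[X i | ⨆ j : Fin n, ⨆ _ : (j : ℕ) < (i : ℕ),
          MeasurableSpace.comap (X j) inferInstance] =ᵐ[P] fun _ => μi i) (t : ℝ)
    (k : ℕ) (hk : k ≤ n) :
    ∫ ω, Real.exp (t * ∑ i ∈ Finset.univ.filter (fun i : Fin n => (i : ℕ) < k), X i ω) ∂P ≤
      Real.exp ((Real.exp t - 1) * ∑ i ∈ Finset.univ.filter (fun i : Fin n => (i : ℕ) < k), μi i) := by
  induction k with
  | zero => simp
  | succ k ih =>
    have hkn : k < n := hk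
    specialize ih hkn.le
    have hs : (Finset.univ.filter fun i : Fin n => (i : ℕ) < k + 1) =
        insert ⟨k, hkn⟩ (Finset.univ.filter fun i : Fin n => (i : ℕ) < k) := by
      ext i
      simp [Fin.ext_iff]; omega
    have hns : (⟨k, hkn⟩ : Fin n) ∉ (Finset.univ.filter fun i : Fin n => (i : ℕ) < k) := by simp
    have hi := chern_int P X hmeas hbdd t (Finset.univ.filter fun i : Fin n => (i : ℕ) < k + 1)
    have hYi := chern_int P X hmeas hbdd t (Finset.univ.filter fun i : Fin n => (i : ℕ) < k)
    rw [hs] at hi ⊢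
    have hsp : ∀ ω, Real.exp (t * ∑ i ∈ insert ⟨k, hkn⟩
        (Finset.univ.filter fun i : Fin n => (i : ℕ) < k), X i ω) =
        Real.exp (t * ∑ i ∈ Finset.univ.filter (fun i : Fin n => (i : ℕ) < k), X i ω) * Real.exp (t * X ⟨k, hkn⟩ ω) := by
      intro ω
      rw [Finset.sum_insert hns, ← Real.exp_add]; congr 1; ring
    simp only [hsp] at hi ⊢
    refine (chern_step P ?_ _ _ _ t (hmeas ⟨k, hkn⟩) (hbdd _) (hcond ⟨k, hkn⟩) ?_ hYi
      (fun _ => (Real.exp_pos _).le) hi).trans ?_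
    · exact iSup_le fun j => iSup_le fun _ => (hmeas j).comap_le
    · refine Measurable.stronglyMeasurable ?_
      refine Real.measurable_exp.comp (Measurable.const_mul ?_ t)
      refine Finset.measurable_sum _ fun j hj => ?_
      rw [measurable_iff_comap_le]
      exact le_iSup₂_of_le j (by simpa using hj) le_rfl
    · rw [Finset.sum_insert hns, mul_add, Real.exp_add, mul_comm]
      exact mul_le_mul_of_nonneg_left ih (Real.exp_pos _).le


/-- Chernoff bounds for sums of `[0,1]`-valued random variables whose conditional
means, given the σ-algebra generated by the preceding variables, are fixed constants
(Proposition 1 of the paper). The lower-tail bound is stated for `0 < δ ≤ 1`, the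
expression `(1-δ)^{1-δ}` being interpreted by the real-power convention `0^0 = 1`
at `δ = 1` (for `δ > 1` the lower-tail bound is vacuous). -/
theorem chernoff_with_fixed_conditional_means
    {Ω : Type} [MeasurableSpace Ω] (P : Measure Ω) [IsProbabilityMeasure P]
    (n : ℕ) (X : Fin n → Ω → ℝ) (μi : Fin n → ℝ)
    (hmeas : ∀ i, Measurable (X i))
    (hbdd : ∀ i, ∀ᵐ ω ∂P, X i ω ∈ Set.Icc (0 : ℝ) 1)
    (hcond : ∀ i : Fin n,
      P[X i | ⨆ j : Fin n, ⨆ _ : (j : ℕ) < (i : ℕ),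
          MeasurableSpace.comap (X j) inferInstance] =ᵐ[P] fun _ => μi i) :
    ∀ δ : ℝ, 0 < δ →
      ((P {ω | (1 + δ) * (∑ i, μi i) ≤ ∑ i, X i ω}).toReal ≤
        (Real.exp δ / (1 + δ) ^ ((1 : ℝ) + δ)) ^ (∑ i, μi i)) ∧
      (δ ≤ 1 →
        (P {ω | ∑ i, X i ω ≤ (1 - δ) * (∑ i, μi i)}).toReal ≤
          (Real.exp (-δ) / (1 - δ) ^ ((1 : ℝ) - δ)) ^ (∑ i, μi i)) := by
  have hint : ∀ t, Integrable (fun ω => Real.exp (t * ∑ i, X i ω)) P :=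
    fun t => chern_int P X hmeas hbdd t Finset.univ
  have hmgf : ∀ t, mgf (fun ω => ∑ i, X i ω) P t ≤
      Real.exp ((Real.exp t - 1) * ∑ i, μi i) := by
    intro t
    have h := chern_mgf P n X μi hmeas hbdd hcond t n le_rfl
    simpa [mgf] using h
  set M := ∑ i, μi i with hM
  intro δ hδ
  constructor
  · have h1 : 0 < 1 + δ := by linarith
    have ht : 0 ≤ Real.log (1 + δ) := Real.log_nonneg (by linarith)
    refine (measure_ge_le_exp_mul_mgf ((1 + δ) * M) ht (hint _)).trans ?_
    refine (mul_le_mul_of_nonneg_left (hmgf _) (Real.exp_pos _).le).trans (le_of_eq ?_)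
    rw [Real.exp_log h1, Real.rpow_def_of_pos h1, ← Real.exp_sub, ← Real.exp_mul, ← Real.exp_add]
    congr 1; ring
  · intro hδ1
    rcases hδ1.lt_or_eq with h | rfl
    · have h1 : 0 < 1 - δ := by linarith
      have ht : Real.log (1 - δ) ≤ 0 := Real.log_nonpos h1.le (by linarith)
      refine (measure_le_le_exp_mul_mgf ((1 - δ) * M) ht (hint _)).trans ?_
      refine (mul_le_mul_of_nonneg_left (hmgf _) (Real.exp_pos _).le).trans (le_of_eq ?_)
      rw [Real.exp_log h1, Real.rpow_def_of_pos h1, ← Real.exp_sub, ← Real.exp_mul,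
        ← Real.exp_add]
      congr 1; ring
    · have key : ∀ t : ℝ, t ≤ 0 → (P {ω | ∑ i, X i ω ≤ (1 - 1) * M}).toReal ≤
          Real.exp ((Real.exp t - 1) * M) := by
        intro t ht
        refine (measure_le_le_exp_mul_mgf ((1 - 1) * M) ht (hint _)).trans ?_
        refine (mul_le_mul_of_nonneg_left (hmgf _) (Real.exp_pos _).le).trans (le_of_eq ?_)
        simp
      have hlim : Filter.Tendsto (fun t : ℝ => Real.exp ((Real.exp t - 1) * M)) Filter.atBot
          (nhds (Real.exp ((0 - 1) * M))) :=
        (Real.continuous_exp.tendsto _).comp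
          ((Real.tendsto_exp_atBot.sub_const 1).mul_const M)
      refine (ge_of_tendsto hlim ((Filter.eventually_le_atBot 0).mono key)).trans (le_of_eq ?_)
      rw [sub_self, Real.rpow_zero, div_one, ← Real.exp_mul]
      congr 1; ring
end
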